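/- arXiv:2602.12219 — 3 statements merged into one kernel-verified Lean document; each statement's English description precedes it below -/
import Mathlib

section
/- Let R be a finite chain ring of length 2 with maximal ideal N and residue field F_q, and fix a free rank-1 submodule P of the left R-module R^4. The number of submodules of R^4 that are isomorphic to R ⊕ R ⊕ R/N (i.e., of shape (2,2,1)) and contain P equals q(q+1)(q²+q+1). -/
structure CRing {R : Type*} [Ring R] [Finite R] (N : Ideal R) (θ : R) (q : ℕ) : Prop where
  unit : ∀ x, x ∉ N → IsUnit x
  rmul : ∀ a ∈ N, ∀ x, a * x ∈ N
  zero : ∀ x, θ * x = 0 ↔ x ∈ N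
  mem : θ ∈ N
  gen : ∀ a ∈ N, ∃ x, a = θ * x
  sq : ∀ a ∈ N, ∀ b ∈ N, a * b = 0
  cardN : Nat.card N = q
  cardQ : Nat.card (R ⧸ N) = q
  cardR : Nat.card R = q ^ 2
  one_lt : 1 < q

theorem cring_of {R : Type*} [Ring R] [Finite R] (q : ℕ)
    (hchain : ∀ I J : Ideal R, I ≤ J ∨ J ≤ I)
    (N : Ideal R) (hN : N.IsMaximal)
    (hN2 : ∀ a ∈ N, ∀ b ∈ N, a * b = 0) (hNne : N ≠ ⊥)
    (hq : Nat.card (R ⧸ N) = q) (hq' : IsPrimePow q) : ∃ θ, CRing N θ q := by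
  have unit : ∀ x, x ∉ N → IsUnit x := by
    intro x hx
    have h1 : N < Ideal.span {x} := by
      refine lt_of_le_of_ne ?_ ?_
      · rcases hchain N (Ideal.span {x}) with h | h
        · exact h
        · exact absurd (h (Ideal.subset_span rfl)) hx
      · intro h
        exact hx (h ▸ Ideal.subset_span rfl)
    have h2 := hN.1.2 _ h1
    have h3 : (1 : R) ∈ Ideal.span {x} := by rw [h2]; trivial
    obtain ⟨y, hy⟩ := Ideal.mem_span_singleton'.1 h3
    exact IsUnit.of_mul_eq_one y (mul_eq_one_symm hy)
  have one : (1 : R) ∉ N := fun h => hN.1.1 ((Ideal.eq_top_iff_one N).2 h)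
  have rmul : ∀ a ∈ N, ∀ x, a * x ∈ N := by
    intro a ha x
    by_contra h
    obtain ⟨u, hu⟩ := unit _ h
    have h1 : (↑u⁻¹ * a) * x = 1 := by rw [mul_assoc, ← hu]; simp
    have h2 := mul_eq_one_symm h1
    apply one
    rw [← h2, ← mul_assoc]
    exact N.mul_mem_left _ ha
  obtain ⟨θ, hθ, hθ0⟩ := (Submodule.ne_bot_iff N).1 hNne
  have zero : ∀ x, θ * x = 0 ↔ x ∈ N := by
    intro x
    refine ⟨fun h => ?_, fun h => hN2 _ hθ _ h⟩
    by_contra hx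
    obtain ⟨u, rfl⟩ := unit x hx
    exact hθ0 (by simpa using h)
  have zero' : ∀ x, x * θ = 0 ↔ x ∈ N := by
    intro x
    refine ⟨fun h => ?_, fun h => hN2 _ h _ hθ⟩
    by_contra hx
    obtain ⟨u, rfl⟩ := unit x hx
    exact hθ0 (by simpa using h)
  have lgen : ∀ a ∈ N, ∃ x, x * θ = a := by
    intro a ha
    rcases hchain (Ideal.span {a}) (Ideal.span {θ}) with h | h
    · exact Ideal.mem_span_singleton'.1 (h (Ideal.subset_span rfl))
    · obtain ⟨r, hr⟩ := Ideal.mem_span_singleton'.1 (h (Ideal.subset_span rfl))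
      have : r ∉ N := fun h => hθ0 (by rw [← hr]; exact hN2 _ h _ ha)
      obtain ⟨u, rfl⟩ := unit r this
      exact ⟨↑u⁻¹, by rw [← hr]; simp⟩
  have hRN : Nat.card R = Nat.card N * Nat.card (R ⧸ N) := by
    simpa using Submodule.card_eq_card_quotient_mul_card N
  have hcN : Nat.card N = q := by
    let f : R →+ R := AddMonoidHom.mulRight θ
    have e := QuotientAddGroup.quotientKerEquivRange f
    have hk : f.ker = N.toAddSubgroup := by
      ext x; simp [f, AddMonoidHom.mem_ker, zero']
    have hr : f.range = N.toAddSubgroup := by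
      ext x
      constructor
      · rintro ⟨y, rfl⟩; exact N.mul_mem_left _ hθ
      · intro h; exact lgen x h
    have := Nat.card_congr e.toEquiv
    rw [hk, hr] at this
    exact this.symm.trans hq
  have rgen : ∀ a ∈ N, ∃ x, a = θ * x := by
    let f : R →+ R := AddMonoidHom.mulLeft θ
    have e := QuotientAddGroup.quotientKerEquivRange f
    have hk : f.ker = N.toAddSubgroup := by
      ext x; simp [f, AddMonoidHom.mem_ker, zero]
    have h0 := Nat.card_congr e.toEquiv
    rw [hk] at h0
    have h1 : Nat.card f.range = q := h0.symm.trans hq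
    have h2 : f.range ≤ N.toAddSubgroup := by
      rintro _ ⟨y, rfl⟩; exact rmul _ hθ _
    have h3 : f.range = N.toAddSubgroup :=
      AddSubgroup.eq_of_le_of_card_ge h2 (by rw [h1]; exact hcN.le)
    intro a ha
    have : a ∈ f.range := by rw [h3]; exact ha
    obtain ⟨x, hx⟩ := this
    exact ⟨x, hx.symm⟩
  exact ⟨θ, unit, rmul, zero, hθ, rgen, hN2, hcN, hq, by rw [hRN, hcN, hq, sq], hq'.one_lt⟩

theorem card_sup_inf {R M : Type*} [Ring R] [AddCommGroup M] [Module R M] [Finite M]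
    (A B : Submodule R M) :
    Nat.card ↥(A ⊔ B) * Nat.card ↥(A ⊓ B) = Nat.card A * Nat.card B := by
  have h := Nat.card_congr (LinearMap.quotientInfEquivSupQuotient A B).toEquiv
  have h1 := Submodule.card_eq_card_quotient_mul_card (Submodule.comap A.subtype (A ⊓ B))
  have h2 := Submodule.card_eq_card_quotient_mul_card (Submodule.comap (A ⊔ B).subtype B)
  have h3 := Nat.card_congr (Submodule.comapSubtypeEquivOfLe (inf_le_left : A ⊓ B ≤ A)).toEquiv
  have h4 := Nat.card_congr (Submodule.comapSubtypeEquivOfLe (le_sup_right : B ≤ A ⊔ B)).toEquiv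
  rw [h3] at h1
  rw [h4] at h2
  rw [Submodule.comap_inf] at h1
  rw [h1, h2, h]
  ring

section
variable {R : Type*} [Ring R] [Finite R] {N : Ideal R} {θ : R} {q : ℕ}
set_option linter.unusedSectionVars false
variable {M : Type*} [AddCommGroup M] [Module R M] [Finite M]

theorem indep1 (h : CRing N θ q) (S : Submodule R M)
    (hS : ∀ m, m ∈ S ↔ θ • m = 0) (p : M) (hp : ∀ a : R, a • p = 0 → a = 0) (a : R)
    (ha : a • p ∈ S) : a ∈ N := by
  rw [hS, smul_smul] at ha
  exact (h.zero a).1 (hp _ ha)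

theorem NS (h : CRing N θ q) (S : Submodule R M)
    (hS : ∀ m, m ∈ S ↔ θ • m = 0) (a : R) (ha : a ∈ N) (m : M) : a • m ∈ S := by
  rw [hS, smul_smul, h.sq _ h.mem _ ha, zero_smul]

theorem indep2 (h : CRing N θ q) (S : Submodule R M)
    (hS : ∀ m, m ∈ S ↔ θ • m = 0) (p : M) (hp : ∀ a : R, a • p = 0 → a = 0)
    (v : M) (hv : v ∉ Submodule.span R {p} ⊔ S) (a b : R)
    (hab : a • p + b • v ∈ S) : a ∈ N ∧ b ∈ N := by
  have hb : b ∈ N := by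
    by_contra hb
    obtain ⟨u, rfl⟩ := h.unit b hb
    apply hv
    have h1 : v = (-(↑u⁻¹ * a)) • p + (↑u⁻¹ : R) • (a • p + (u : R) • v) := by
      rw [smul_add, smul_smul, smul_smul]; simp
    rw [h1]
    exact Submodule.add_mem_sup (Submodule.smul_mem _ _ (Submodule.subset_span rfl))
      (Submodule.smul_mem _ _ hab)
  refine ⟨indep1 h S hS p hp a ?_, hb⟩
  exact (Submodule.add_mem_iff_left _ (NS h S hS b hb v)).1 hab

theorem indep2' (h : CRing N θ q) (S : Submodule R M)
    (hS : ∀ m, m ∈ S ↔ θ • m = 0) (p : M) (hp : ∀ a : R, a • p = 0 → a = 0)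
    (v : M) (hv : v ∉ Submodule.span R {p} ⊔ S) (a b : R)
    (hab : a • p + b • v = 0) : a = 0 ∧ b = 0 := by
  obtain ⟨ha, hb⟩ := indep2 h S hS p hp v hv a b (by rw [hab]; exact S.zero_mem)
  obtain ⟨x, rfl⟩ := h.gen a ha
  obtain ⟨y, rfl⟩ := h.gen b hb
  obtain ⟨hx, hy⟩ := indep2 h S hS p hp v hv x y
    (by rw [hS, smul_add, smul_smul, smul_smul]; exact hab)
  exact ⟨(h.zero x).2 hx, (h.zero y).2 hy⟩

theorem card1 (h : CRing N θ q) (S : Submodule R M)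
    (hS : ∀ m, m ∈ S ↔ θ • m = 0) (p : M) (hp : ∀ a : R, a • p = 0 → a = 0) :
    Nat.card ↥(Submodule.span R {p} ⊓ S) = q := by
  rw [← h.cardN]
  symm
  refine Nat.card_congr (Equiv.ofBijective
    (fun a : N => ⟨a.1 • p, Submodule.smul_mem _ _ (Submodule.subset_span rfl),
      NS h S hS a.1 a.2 p⟩) ⟨?_, ?_⟩)
  · intro a b hab
    have : a.1 • p = b.1 • p := congrArg Subtype.val hab
    rw [← sub_eq_zero, ← sub_smul] at this
    exact Subtype.ext (sub_eq_zero.1 (hp _ this))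
  · rintro ⟨m, h1, h2⟩
    obtain ⟨a, rfl⟩ := Submodule.mem_span_singleton.1 h1
    exact ⟨⟨a, indep1 h S hS p hp a h2⟩, rfl⟩

theorem cardP (h : CRing N θ q) (p : M) (hp : ∀ a : R, a • p = 0 → a = 0) :
    Nat.card ↥(Submodule.span R {p}) = q ^ 2 := by
  rw [← h.cardR]
  symm
  refine Nat.card_congr (Equiv.ofBijective
    (fun a : R => ⟨a • p, Submodule.smul_mem _ _ (Submodule.subset_span rfl)⟩) ⟨?_, ?_⟩)
  · intro a b hab
    have : a • p = b • p := congrArg Subtype.val hab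
    rw [← sub_eq_zero, ← sub_smul] at this
    exact (sub_eq_zero.1 (hp _ this))
  · rintro ⟨m, h1⟩
    obtain ⟨a, rfl⟩ := Submodule.mem_span_singleton.1 h1
    exact ⟨a, rfl⟩

theorem card2 (h : CRing N θ q) (S : Submodule R M)
    (hS : ∀ m, m ∈ S ↔ θ • m = 0) (p : M) (hp : ∀ a : R, a • p = 0 → a = 0)
    (v : M) (hv : v ∉ Submodule.span R {p} ⊔ S) :
    Nat.card ↥((Submodule.span R {p} ⊔ Submodule.span R {v}) ⊓ S) = q ^ 2 := by
  have : q ^ 2 = Nat.card (N × N) := by rw [Nat.card_prod, h.cardN, sq]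
  rw [this]
  symm
  refine Nat.card_congr (Equiv.ofBijective
    (fun a : N × N => ⟨a.1.1 • p + a.2.1 • v,
      Submodule.add_mem_sup (Submodule.smul_mem _ _ (Submodule.subset_span rfl))
        (Submodule.smul_mem _ _ (Submodule.subset_span rfl)),
      S.add_mem (NS h S hS _ a.1.2 p) (NS h S hS _ a.2.2 v)⟩) ⟨?_, ?_⟩)
  · rintro ⟨⟨a, ha⟩, ⟨b, hb⟩⟩ ⟨⟨a', ha'⟩, ⟨b', hb'⟩⟩ hab
    have h1 : a • p + b • v = a' • p + b' • v := congrArg Subtype.val hab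
    have h2 : (a - a') • p + (b - b') • v = 0 := by
      rw [sub_smul, sub_smul, sub_add_sub_comm, h1, sub_self]
    obtain ⟨h3, h4⟩ := indep2' h S hS p hp v hv _ _ h2
    rw [sub_eq_zero] at h3 h4
    subst h3 h4
    rfl
  · rintro ⟨m, h1, h2⟩
    obtain ⟨x, hx, y, hy, rfl⟩ := Submodule.mem_sup.1 h1
    obtain ⟨a, rfl⟩ := Submodule.mem_span_singleton.1 hx
    obtain ⟨b, rfl⟩ := Submodule.mem_span_singleton.1 hy
    obtain ⟨h3, h4⟩ := indep2 h S hS p hp v hv _ _ h2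
    exact ⟨(⟨a, h3⟩, ⟨b, h4⟩), rfl⟩

theorem card_diff (A B : Submodule R M) :
    Nat.card {x : M // x ∈ A ∧ x ∉ B} = Nat.card A - Nat.card ↥(A ⊓ B) := by
  have h1 := Set.ncard_inter_add_ncard_sdiff_eq_ncard (A : Set M) (B : Set M)
  have e1 : Nat.card {x : M // x ∈ A ∧ x ∉ B} = ((A : Set M) \ B).ncard := rfl
  have e2 : Nat.card A = (A : Set M).ncard := rfl
  have e3 : Nat.card ↥(A ⊓ B) = ((A : Set M) ∩ B).ncard := rfl
  omega

theorem count_pairs (h : CRing N θ q) (S : Submodule R M)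
    (hS : ∀ m, m ∈ S ↔ θ • m = 0) (p : M) (hp : ∀ a : R, a • p = 0 → a = 0)
    (U : Submodule R M) (hU : p ∈ U) (u s : ℕ) (hu : Nat.card U = u)
    (hs : Nat.card ↥(U ⊓ S) = s) :
    Nat.card {x : M × M // (x.1 ∉ Submodule.span R {p} ⊔ S ∧ x.2 ∈ S ∧
      x.2 ∉ Submodule.span R {p} ⊔ Submodule.span R {x.1}) ∧ x.1 ∈ U ∧ x.2 ∈ U}
      = (u - q * s) * (s - q ^ 2) := by
  have hPU : Submodule.span R {p} ≤ U := by simpa using hU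
  let e : {x : M × M // (x.1 ∉ Submodule.span R {p} ⊔ S ∧ x.2 ∈ S ∧
      x.2 ∉ Submodule.span R {p} ⊔ Submodule.span R {x.1}) ∧ x.1 ∈ U ∧ x.2 ∈ U} ≃
      Σ v : {v : M // v ∈ U ∧ v ∉ Submodule.span R {p} ⊔ S},
        {w : M // w ∈ U ⊓ S ∧ w ∉ Submodule.span R {p} ⊔ Submodule.span R {v.1}} :=
    { toFun := fun x => ⟨⟨x.1.1, x.2.2.1, x.2.1.1⟩, ⟨x.1.2, ⟨x.2.2.2, x.2.1.2.1⟩, x.2.1.2.2⟩⟩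
      invFun := fun y => ⟨(y.1.1, y.2.1), ⟨y.1.2.2, y.2.2.1.2, y.2.2.2⟩, y.1.2.1, y.2.2.1.1⟩
      left_inv := fun _ => rfl
      right_inv := fun _ => rfl }
  rw [Nat.card_congr e]
  have hw : ∀ v : {v : M // v ∈ U ∧ v ∉ Submodule.span R {p} ⊔ S},
      Nat.card {w : M // w ∈ U ⊓ S ∧ w ∉ Submodule.span R {p} ⊔ Submodule.span R {v.1}}
        = s - q ^ 2 := by
    intro v
    rw [card_diff, hs, ← card2 h S hS p hp v.1 v.2.2]
    have : (U ⊓ S) ⊓ (Submodule.span R {p} ⊔ Submodule.span R {v.1}) =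
        (Submodule.span R {p} ⊔ Submodule.span R {v.1}) ⊓ S := by
      have h1 : Submodule.span R {p} ⊔ Submodule.span R {v.1} ≤ U :=
        sup_le hPU (by simpa using v.2.1)
      rw [inf_right_comm, inf_eq_right.2 h1]
    rw [this]
  classical
  have := Fintype.ofFinite {v : M // v ∈ U ∧ v ∉ Submodule.span R {p} ⊔ S}
  rw [Nat.card_sigma, Finset.sum_congr rfl (fun v _ => hw v), Finset.sum_const,
    Finset.card_univ, ← Nat.card_eq_fintype_card, card_diff, smul_eq_mul, hu]
  congr 2
  have h1 : U ⊓ (Submodule.span R {p} ⊔ S) = Submodule.span R {p} ⊔ (U ⊓ S) := by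
    rw [inf_comm U S, ← sup_inf_assoc_of_le _ hPU, inf_comm]
  have h2 := card_sup_inf (Submodule.span R {p}) (U ⊓ S)
  rw [← h1, ← inf_assoc, inf_eq_left.2 hPU, card1 h S hS p hp, cardP h p hp, hs] at h2
  have : 0 < q := by have := h.one_lt; omega
  apply Nat.eq_of_mul_eq_mul_right this
  rw [h2]; ring

theorem shape (h : CRing N θ q) (S : Submodule R M)
    (hS : ∀ m, m ∈ S ↔ θ • m = 0) (hSN : ∀ m ∈ S, ∀ a ∈ N, a • m = 0)
    (p : M) (hp : ∀ a : R, a • p = 0 → a = 0)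
    (v : M) (hv : v ∉ Submodule.span R {p} ⊔ S) (w : M) (hw : w ∈ S)
    (hw' : w ∉ Submodule.span R {p} ⊔ Submodule.span R {v}) :
    Nonempty (↥(Submodule.span R {p} ⊔ Submodule.span R {v} ⊔ Submodule.span R {w})
      ≃ₗ[R] ((Fin 2 → R) × (R ⧸ N))) := by
  obtain ⟨f, hf⟩ : ∃ f : ((Fin 2 → R) × (R ⧸ N)) →ₗ[R] M,
      ∀ (a : Fin 2 → R) (c : R), f (a, Submodule.Quotient.mk c) =
      a 0 • p + a 1 • v + c • w := by
   let g : (R ⧸ N) →ₗ[R] M := Submodule.liftQ N (LinearMap.toSpanSingleton R M w)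
    (fun a ha => by simpa using hSN w hw a ha)
   let f0 : (Fin 2 → R) →ₗ[R] M := Fintype.linearCombination R ![p, v]
   refine ⟨f0.coprod g, ?_⟩
   · intro a c
     simp [f0, g, Fintype.linearCombination_apply, Fin.sum_univ_two]
  have hinj : Function.Injective f := by
    rw [injective_iff_map_eq_zero]
    rintro ⟨a, c⟩ h0
    obtain ⟨c, rfl⟩ := Submodule.Quotient.mk_surjective N c
    rw [hf] at h0
    have hc : c ∈ N := by
      by_contra hc
      obtain ⟨u, rfl⟩ := h.unit c hc
      apply hw'
      have h1 : w = (-(↑u⁻¹ : R)) • (a 0 • p + a 1 • v) := by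
        have h2 : a 0 • p + a 1 • v = - ((u : R) • w) := eq_neg_of_add_eq_zero_left h0
        rw [h2, smul_neg, neg_smul, smul_smul]; simp
      rw [h1]
      exact Submodule.smul_mem _ _ (Submodule.add_mem_sup
        (Submodule.smul_mem _ _ (Submodule.subset_span rfl))
        (Submodule.smul_mem _ _ (Submodule.subset_span rfl)))
    rw [hSN w hw c hc, add_zero] at h0
    obtain ⟨h3, h4⟩ := indep2' h S hS p hp v hv _ _ h0
    have ha : a = 0 := by
      ext i; fin_cases i
      · exact h3
      · exact h4
    have hc' : (Submodule.Quotient.mk c : R ⧸ N) = 0 := (Submodule.Quotient.mk_eq_zero N).2 hc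
    rw [ha, hc']; rfl
  have hrange : LinearMap.range f =
      Submodule.span R {p} ⊔ Submodule.span R {v} ⊔ Submodule.span R {w} := by
    ext m
    constructor
    · rintro ⟨⟨a, c⟩, rfl⟩
      obtain ⟨c, rfl⟩ := Submodule.Quotient.mk_surjective N c
      rw [hf]
      exact Submodule.add_mem_sup (Submodule.add_mem_sup
        (Submodule.smul_mem _ _ (Submodule.subset_span rfl))
        (Submodule.smul_mem _ _ (Submodule.subset_span rfl)))
        (Submodule.smul_mem _ _ (Submodule.subset_span rfl))
    · intro hm
      obtain ⟨t, ht, z, hz, rfl⟩ := Submodule.mem_sup.1 hm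
      obtain ⟨x, hx, y, hy, rfl⟩ := Submodule.mem_sup.1 ht
      clear hm ht
      obtain ⟨a, rfl⟩ := Submodule.mem_span_singleton.1 hx
      obtain ⟨b, rfl⟩ := Submodule.mem_span_singleton.1 hy
      obtain ⟨c, rfl⟩ := Submodule.mem_span_singleton.1 hz
      exact ⟨(![a, b], Submodule.Quotient.mk c), hf ![a, b] c⟩
  rw [← hrange]
  exact ⟨(LinearEquiv.ofInjective f hinj).symm⟩

theorem card_shape (h : CRing N θ q) (U : Submodule R M)
    (e : U ≃ₗ[R] ((Fin 2 → R) × (R ⧸ N))) : Nat.card U = q ^ 5 := by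
  rw [Nat.card_congr e.toEquiv, Nat.card_prod, Nat.card_fun, h.cardQ, h.cardR]
  simp; ring

theorem card_socle (h : CRing N θ q) (S : Submodule R M)
    (hS : ∀ m, m ∈ S ↔ θ • m = 0) (U : Submodule R M)
    (e : U ≃ₗ[R] ((Fin 2 → R) × (R ⧸ N))) : Nat.card ↥(U ⊓ S) = q ^ 3 := by
  have h1 : Nat.card ((Fin 2 → N) × (R ⧸ N)) = q ^ 3 := by
    rw [Nat.card_prod, Nat.card_fun, h.cardQ, h.cardN]
    simp; ring
  rw [← h1]
  symm
  have hQ : ∀ c : R ⧸ N, θ • c = 0 := by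
    intro c
    obtain ⟨c, rfl⟩ := Submodule.Quotient.mk_surjective N c
    rw [← Submodule.Quotient.mk_smul, Submodule.Quotient.mk_eq_zero]
    exact h.rmul _ h.mem _
  have key : ∀ x : (Fin 2 → R) × (R ⧸ N), θ • x = 0 ↔ ∀ i, x.1 i ∈ N := by
    rintro ⟨a, c⟩
    rw [Prod.smul_mk, hQ, Prod.mk_eq_zero, funext_iff]
    simp [h.zero]
  have key2 : ∀ x : (Fin 2 → R) × (R ⧸ N), (e.symm x : M) ∈ S ↔ ∀ i, x.1 i ∈ N := by
    intro x
    rw [hS, ← key, ← Submodule.coe_smul, ← map_smul, Submodule.coe_eq_zero]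
    exact e.symm.map_eq_zero_iff
  refine Nat.card_congr (Equiv.ofBijective
    (fun x : (Fin 2 → N) × (R ⧸ N) =>
      (⟨e.symm (fun i => (x.1 i : R), x.2), (e.symm _).2, (key2 _).2 fun i => (x.1 i).2⟩ :
        ↥(U ⊓ S))) ⟨?_, ?_⟩)
  · rintro ⟨a, c⟩ ⟨b, d⟩ hab
    have h2 : ((fun i => (a i : R), c) : (Fin 2 → R) × (R ⧸ N)) = (fun i => (b i : R), d) :=
      e.symm.injective (Subtype.ext (by
        have h3 := Subtype.ext_iff.1 hab
        exact h3))
    rw [Prod.mk.injEq, funext_iff] at h2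
    refine Prod.ext (funext fun i => Subtype.ext (h2.1 i)) h2.2
  · rintro ⟨m, h2, h3⟩
    have h4 := (key2 (e ⟨m, h2⟩)).1 (by simpa using h3)
    refine ⟨(fun i => ⟨(e ⟨m, h2⟩).1 i, h4 i⟩, (e ⟨m, h2⟩).2), ?_⟩
    apply Subtype.ext
    simp

theorem count_main (h : CRing N θ q) (S : Submodule R M)
    (hS : ∀ m, m ∈ S ↔ θ • m = 0) (hSN : ∀ m ∈ S, ∀ a ∈ N, a • m = 0)
    (p : M) (hp : ∀ a : R, a • p = 0 → a = 0)
    (hM : Nat.card M = q ^ 8) (hcS : Nat.card S = q ^ 4) :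
    Nat.card {U : Submodule R M //
        Nonempty (U ≃ₗ[R] ((Fin 2 → R) × (R ⧸ N))) ∧ Submodule.span R {p} ≤ U} =
      q * (q + 1) * (q ^ 2 + q + 1) := by
  classical
  let V : M × M → Prop := fun x => x.1 ∉ Submodule.span R {p} ⊔ S ∧ x.2 ∈ S ∧
      x.2 ∉ Submodule.span R {p} ⊔ Submodule.span R {x.1}
  let Y := {U : Submodule R M //
        Nonempty (U ≃ₗ[R] ((Fin 2 → R) × (R ⧸ N))) ∧ Submodule.span R {p} ≤ U}
  let T : {x // V x} → Y := fun x => ⟨Submodule.span R {p} ⊔ Submodule.span R {x.1.1} ⊔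
      Submodule.span R {x.1.2}, shape h S hS hSN p hp _ x.2.1 _ x.2.2.1 x.2.2.2,
      le_sup_of_le_left le_sup_left⟩
  have htot : Nat.card {x // V x} = (q ^ 8 - q * q ^ 4) * (q ^ 4 - q ^ 2) := by
    rw [← count_pairs h S hS p hp ⊤ trivial (q ^ 8) (q ^ 4)
      (by rw [← hM]; exact Nat.card_congr Submodule.topEquiv.toEquiv) (by rw [top_inf_eq, hcS])]
    exact Nat.card_congr (Equiv.subtypeEquivRight fun x => by simp [V])
  have hfib : ∀ U : Y, Nat.card {x // T x = U} = (q ^ 5 - q * q ^ 3) * (q ^ 3 - q ^ 2) := by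
    rintro ⟨U, ⟨e⟩, hU⟩
    rw [← count_pairs h S hS p hp U (by simpa using hU) (q ^ 5) (q ^ 3) (card_shape h U e)
      (card_socle h S hS U e)]
    have hiff : ∀ x : {x // V x}, T x = ⟨U, ⟨e⟩, hU⟩ ↔ x.1.1 ∈ U ∧ x.1.2 ∈ U := by
      intro x
      rw [Subtype.ext_iff]
      constructor
      · intro hx
        change _ = U at hx
        rw [← hx]
        exact ⟨(le_sup_of_le_left le_sup_right : Submodule.span R {x.1.1} ≤ _)
          (Submodule.subset_span rfl), (le_sup_right : Submodule.span R {x.1.2} ≤ _)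
          (Submodule.subset_span rfl)⟩
      · rintro ⟨h1, h2⟩
        have hle : (T x).1 ≤ U := sup_le (sup_le hU (by simpa using h1)) (by simpa using h2)
        obtain ⟨e'⟩ := (T x).2.1
        apply SetLike.coe_injective
        apply Set.eq_of_subset_of_ncard_le hle
        exact ((card_shape h U e).trans (card_shape h _ e').symm).le
    exact Nat.card_congr ((Equiv.subtypeEquivRight hiff).trans
      (Equiv.subtypeSubtypeEquivSubtypeInter V (fun x => x.1 ∈ U ∧ x.2 ∈ U)))
  have : Finite Y := Subtype.finite
  have := Fintype.ofFinite Y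
  have hsum : Nat.card {x // V x} = Nat.card Y * ((q ^ 5 - q * q ^ 3) * (q ^ 3 - q ^ 2)) := by
    rw [← Nat.card_congr (Equiv.sigmaFiberEquiv T), Nat.card_sigma,
      Finset.sum_congr rfl (fun U _ => hfib U), Finset.sum_const,
      Finset.card_univ, ← Nat.card_eq_fintype_card, smul_eq_mul]
  rw [htot] at hsum
  change Nat.card Y = _
  obtain ⟨k, rfl⟩ : ∃ k, q = k + 2 := ⟨q - 2, by have := h.one_lt; omega⟩
  generalize Nat.card Y = y at hsum
  set q := k + 2
  have e1 : q ^ 8 - q * q ^ 4 = q ^ 5 * (q ^ 2 + q + 1) * (k + 1) :=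
    Nat.sub_eq_of_eq_add (by simp only [q]; ring)
  have e2 : q ^ 4 - q ^ 2 = q ^ 2 * (q + 1) * (k + 1) :=
    Nat.sub_eq_of_eq_add (by simp only [q]; ring)
  have e3 : q ^ 5 - q * q ^ 3 = q ^ 4 * (k + 1) :=
    Nat.sub_eq_of_eq_add (by simp only [q]; ring)
  have e4 : q ^ 3 - q ^ 2 = q ^ 2 * (k + 1) :=
    Nat.sub_eq_of_eq_add (by simp only [q]; ring)
  rw [e1, e2, e3, e4] at hsum
  have hpos : 0 < q ^ 4 * (k + 1) * (q ^ 2 * (k + 1)) := by positivity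
  apply Nat.eq_of_mul_eq_mul_right hpos
  rw [← hsum]; ring

end


/-- **Counting line stripes through a point of `PHG(3,R)`.** Let `R` be a finite chain
ring of length 2 (its left ideals form a chain, its maximal ideal `N` satisfies
`N² = 0`, `N ≠ 0`, and `R/N ≅ F_q`), and fix a free rank-1 submodule `P` of `R⁴` (a point
of `PHG(3,R)`). The number of submodules of `R⁴` of shape `(2,2,1)`, i.e. isomorphic to
`R ⊕ R ⊕ R/N`, that contain `P` equals `q(q+1)(q²+q+1)`. -/
theorem count_line_stripes_through_point (q : ℕ) {R : Type*} [Ring R] [Fintype R]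
    (hchain : ∀ I J : Ideal R, I ≤ J ∨ J ≤ I)
    (N : Ideal R) (hN : N.IsMaximal)
    (hN2 : ∀ a ∈ N, ∀ b ∈ N, a * b = 0) (hNne : N ≠ ⊥)
    (hq : Nat.card (R ⧸ N) = q) (hq' : IsPrimePow q)
    (P : Submodule R (Fin 4 → R)) (hP : Nonempty (P ≃ₗ[R] R)) :
    Nat.card {U : Submodule R (Fin 4 → R) //
        Nonempty (U ≃ₗ[R] ((Fin 2 → R) × (R ⧸ N))) ∧ P ≤ U} =
      q * (q + 1) * (q ^ 2 + q + 1) := by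

  obtain ⟨θ, h⟩ := cring_of q hchain N hN hN2 hNne hq hq'
  obtain ⟨e⟩ := hP
  let p : Fin 4 → R := (e.symm 1 : P)
  have hp : ∀ a : R, a • p = 0 → a = 0 := by
    intro a ha
    have h1 : a • e.symm 1 = 0 := Subtype.ext ha
    rw [← map_smul] at h1
    simpa using h1
  have hPp : P = Submodule.span R {p} := by
    apply le_antisymm
    · intro x hx
      rw [Submodule.mem_span_singleton]
      refine ⟨e ⟨x, hx⟩, ?_⟩
      have h1 : e ⟨x, hx⟩ • e.symm 1 = ⟨x, hx⟩ := by rw [← map_smul]; simp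
      exact congrArg Subtype.val h1
    · simp [p]
  rw [hPp]
  let S : Submodule R (Fin 4 → R) := Submodule.pi Set.univ fun _ => N
  have hmem : ∀ m : Fin 4 → R, m ∈ S ↔ ∀ i, m i ∈ N := by intro m; simp [S]
  refine count_main h S ?_ ?_ p hp ?_ ?_
  · intro m
    rw [hmem, funext_iff]
    simp [h.zero]
  · intro m hm a ha
    funext i
    exact hN2 a ha _ ((hmem m).1 hm i)
  · rw [Nat.card_fun, h.cardR]; simp; ring
  · have h1 : Nat.card (Fin 4 → N) = q ^ 4 := by rw [Nat.card_fun, h.cardN]; simp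
    rw [← h1]
    exact Nat.card_congr ((Equiv.subtypeEquivRight hmem).trans
      (Equiv.subtypePiEquivPi (p := fun _ x => x ∈ N)))
end

section
/- Let R be a finite chain ring of length 2 with maximal ideal N and residue field F_q. Let 𝓕 be a family of submodules of R^4, each isomorphic to R ⊕ R ⊕ R/N (shape (2,2,1)), such that any two members of 𝓕 contain a common free rank-1 submodule. Then |𝓕| ≤ q²(q+1)(q²+q+1). -/
namespace LS
open Finset
section abs
variable {R M : Type*} [Ring R] [AddCommGroup M] [Module R M] [Finite M]

lemma card_mono {A B : Submodule R M} (h : A ≤ B) : Nat.card A ≤ Nat.card B :=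
  Nat.card_le_card_of_injective _ (Submodule.inclusion_injective h)

lemma eq_of_card {A B : Submodule R M} (h : A ≤ B) (hc : Nat.card B ≤ Nat.card A) : A = B := by
  apply SetLike.coe_injective
  exact Set.eq_of_subset_of_ncard_le h hc (Set.toFinite _)

lemma card_lt {A B : Submodule R M} (h : A < B) : Nat.card A < Nat.card B := by
  by_contra hc
  exact h.ne (eq_of_card h.le (not_lt.1 hc))

lemma card_rel {A B : Submodule R M} (h : A ≤ B) :
    Nat.card B = Nat.card A * Nat.card (B ⧸ A.submoduleOf B) := by
  rw [Submodule.card_eq_card_quotient_mul_card (A.submoduleOf B),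
    Nat.card_congr (Submodule.submoduleOfEquivOfLe h).toEquiv, mul_comm]

lemma card_sup_inf (A B : Submodule R M) :
    Nat.card (A ⊔ B : Submodule R M) * Nat.card (A ⊓ B : Submodule R M) = Nat.card A * Nat.card B := by
  have h1 := card_rel (inf_le_left : A ⊓ B ≤ A)
  have h2 := card_rel (le_sup_right : B ≤ A ⊔ B)
  have h3 := Nat.card_congr (LinearMap.quotientInfEquivSupQuotient A B).toEquiv
  simp only [Submodule.submoduleOf] at h1 h2
  rw [h1, h2]
  rw [← h3, ← Submodule.comap_inf]
  ring

variable {q : ℕ} (hq : 2 ≤ q) (hP : ∀ A : Submodule R M, ∃ k, Nat.card A = q ^ k)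
include hq hP

lemma step {A B : Submodule R M} (h : A < B) : Nat.card A * q ≤ Nat.card B := by
  obtain ⟨a, ha⟩ := hP A
  obtain ⟨b, hb⟩ := hP B
  have := card_lt h
  rw [ha, hb] at *
  rw [← pow_succ]
  exact Nat.pow_le_pow_right (by omega) ((Nat.pow_lt_pow_iff_right (by omega)).1 this)

lemma inf_eq {D X Y : Submodule R M} (hX : D ≤ X) (hY : D ≤ Y) (hne : X ≠ Y)
    (cX : Nat.card X ≤ Nat.card D * q) (cY : Nat.card Y ≤ Nat.card D * q) : X ⊓ Y = D := by
  by_contra hne'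
  have h1 : D < X ⊓ Y := lt_of_le_of_ne (le_inf hX hY) (Ne.symm hne')
  have h2 := step hq hP h1
  have e1 := eq_of_card (inf_le_left : X ⊓ Y ≤ X) (by omega)
  have e2 := eq_of_card (inf_le_right : X ⊓ Y ≤ Y) (by omega)
  exact hne (e1.symm.trans e2)

lemma star (S : Finset (Submodule R M)) (D T : Submodule R M) (d t n : ℕ)
    (hD : Nat.card D = d) (hT : Nat.card T = t)
    (hS : ∀ X ∈ S, D ≤ X ∧ X ≤ T ∧ Nat.card X = d * q) (hDT : D ≤ T)
    (ht : t = d + n * (d * q - d)) : S.card ≤ n := by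
  classical
  let f : Submodule R M → Finset M := fun X => (Set.toFinite (X : Set M)).toFinset
  have fc : ∀ X : Submodule R M, (f X).card = Nat.card X := fun X => by
    rw [← Set.ncard_eq_toFinset_card]; rfl
  have fm : ∀ {X Y : Submodule R M}, X ≤ Y → f X ⊆ f Y := fun h x => by
    simpa [f] using @h x
  have h1 : (S.biUnion fun X => f X \ f D) ⊆ f T \ f D := by
    apply Finset.biUnion_subset.2
    intro X hX
    exact Finset.sdiff_subset_sdiff (fm (hS X hX).2.1) subset_rfl
  have h2 := Finset.card_le_card h1
  rw [Finset.card_biUnion, Finset.card_sdiff_of_subset (fm hDT), fc, fc, hD, hT] at h2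
  · rw [Finset.sum_congr rfl (g := fun _ => d * q - d)] at h2
    · rw [Finset.sum_const, smul_eq_mul, ht] at h2
      have d0 : 0 < d := hD ▸ Nat.card_pos
      have : d * 2 ≤ d * q := Nat.mul_le_mul_left _ hq
      apply Nat.le_of_mul_le_mul_right (c := d * q - d) _ (by omega)
      omega
    · intro X hX
      rw [Finset.card_sdiff_of_subset (fm (hS X hX).1), fc, fc, hD, (hS X hX).2.2]
  · intro X hX Y hY hne
    have := inf_eq hq hP (hS X hX).1 (hS Y hY).1 hne (by rw [(hS X hX).2.2, hD]) (by rw [(hS Y hY).2.2, hD])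
    rw [Function.onFun, Finset.disjoint_left]
    intro x hx hy
    simp only [f, Finset.mem_sdiff, Set.Finite.mem_toFinset, SetLike.mem_coe] at hx hy
    exact hx.2 (this ▸ ⟨hx.1, hy.1⟩)

/-- Lines in a projective 3-space `[K, ⊤]`, pairwise meeting. -/
lemma ekr (K : Submodule R M) (c : ℕ) (hK : Nat.card K = c) (hM : Nat.card M = c * q ^ 4)
    (S : Finset (Submodule R M)) (hS : ∀ L ∈ S, K ≤ L ∧ Nat.card L = c * q ^ 2)
    (hI : ∀ L ∈ S, ∀ L' ∈ S, K < L ⊓ L') : S.card ≤ q ^ 2 + q + 1 := by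
  classical
  have c0 : 0 < c := hK ▸ Nat.card_pos
  have q0 : 0 < q := by omega
  -- two distinct lines meet in a point
  have pt : ∀ A ∈ S, ∀ B ∈ S, A ≠ B → Nat.card (A ⊓ B : Submodule R M) = c * q := by
    intro A hA B hB hne
    have h1 := step hq hP (hI A hA B hB)
    have h2 : A ⊓ B < A := by
      refine lt_of_le_of_ne inf_le_left fun h => hne ?_
      exact eq_of_card (inf_eq_left.1 h) (by rw [(hS A hA).2, (hS B hB).2])
    have h3 := step hq hP h2
    rw [(hS A hA).2, pow_two, ← mul_assoc] at h3
    have := Nat.le_of_mul_le_mul_right h3 q0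
    rw [hK] at h1
    omega
  -- a line is the span of two distinct points on it
  have span : ∀ L ∈ S, ∀ P Q W : Submodule R M, P ≤ L → Q ≤ L → P ≠ Q → P ≤ W → Q ≤ W →
      Nat.card P = c * q → Nat.card Q = c * q → L ≤ W := by
    intro L hL P Q W hPL hQL hne hPW hQW cP cQ
    have h1 : P < P ⊔ Q := by
      refine lt_of_le_of_ne le_sup_left fun h => hne ?_
      exact (eq_of_card (left_eq_sup.1 h) (by rw [cP, cQ])).symm
    have h2 := step hq hP h1
    have := eq_of_card (sup_le hPL hQL) (by rw [(hS L hL).2]; rw [cP] at h2; nlinarith)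
    exact this ▸ sup_le hPW hQW
  -- lines through a point
  have thr : ∀ P W : Submodule R M, ∀ n, P ≤ W → Nat.card P = c * q →
      Nat.card W = c * q + n * (c * q * q - c * q) → ∀ S' ⊆ S, (∀ L ∈ S', P ≤ L ∧ L ≤ W) →
      S'.card ≤ n := by
    intro P W n hPW cP cW S' hS' h
    refine star hq hP S' P W _ _ n cP cW (fun X hX => ⟨(h X hX).1, (h X hX).2, ?_⟩) hPW rfl
    rw [(hS X (hS' hX)).2]; ring
  by_cases hsub : S.card ≤ 1
  · omega
  obtain ⟨A, hA, B, hB, hAB⟩ := Finset.one_lt_card.1 (not_le.1 hsub)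
  obtain ⟨r, rfl⟩ : ∃ r, q = r + 1 := ⟨q - 1, by omega⟩
  have hsubt : ∀ a : ℕ, a * (r + 1) - a = a * r := fun a => by
    rw [mul_add, mul_one, Nat.add_sub_cancel]
  have cp := pt A hA B hB hAB
  by_cases hall : ∀ L ∈ S, A ⊓ B ≤ L
  · refine thr (A ⊓ B) ⊤ _ le_top cp ?_ S subset_rfl (fun L hL => ⟨hall L hL, le_top⟩)
    rw [hsubt, Nat.card_congr (Submodule.topEquiv (R := R) (M := M)).toEquiv, hM]
    ring
  push Not at hall
  obtain ⟨C, hC, hCp⟩ := hall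
  -- plane
  have cW : Nat.card (A ⊔ B : Submodule R M) = c * (r + 1) ^ 3 := by
    have := card_sup_inf A B
    rw [cp, (hS A hA).2, (hS B hB).2] at this
    apply Nat.eq_of_mul_eq_mul_right (Nat.mul_pos c0 q0)
    rw [this]; ring
  have key : ∀ L ∈ S, ¬ (A ⊓ B ≤ L) → L ≤ A ⊔ B := by
    intro L hL hn
    have hLA : L ≠ A := fun h => hn (h ▸ inf_le_left)
    have hLB : L ≠ B := fun h => hn (h ▸ inf_le_right)
    refine span L hL (L ⊓ A) (L ⊓ B) _ inf_le_left inf_le_left ?_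
      (inf_le_right.trans le_sup_left) (inf_le_right.trans le_sup_right)
      (pt L hL A hA hLA) (pt L hL B hB hLB)
    intro he
    have h1 : L ⊓ A ≤ A ⊓ B := le_inf inf_le_right (he ▸ inf_le_right)
    have := eq_of_card h1 (by rw [cp, pt L hL A hA hLA])
    exact hn (this ▸ inf_le_left)
  have inW : ∀ L ∈ S, L ≤ A ⊔ B := by
    intro L hL
    by_cases hp : A ⊓ B ≤ L
    · have hLC : L ≠ C := fun h => hCp (h ▸ hp)
      refine span L hL (A ⊓ B) (L ⊓ C) _ hp inf_le_left ?_ (inf_le_left.trans le_sup_left)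
        (inf_le_right.trans (key C hC hCp)) cp (pt L hL C hC hLC)
      intro he
      exact hCp (he ▸ inf_le_right)
    · exact key L hL hp
  -- count
  have hcount : (S.erase A).card ≤ (r + 1) * ((S.erase A).image (fun L => L ⊓ A)).card := by
    apply Finset.card_le_mul_card_image
    intro P hPim
    obtain ⟨L0, hL0, rfl⟩ := Finset.mem_image.1 hPim
    have hL0' := Finset.mem_erase.1 hL0
    have h3 : (insert A ((S.erase A).filter fun L => L ⊓ A = L0 ⊓ A)).card ≤ r + 1 + 1 := by
      refine thr (L0 ⊓ A) (A ⊔ B) _ (inf_le_right.trans le_sup_left)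
        (pt L0 hL0'.2 A hA hL0'.1) ?_ _ ?_ ?_
      · rw [hsubt, cW]; ring
      · intro x hx
        simp only [Finset.mem_insert, Finset.mem_filter, Finset.mem_erase] at hx
        rcases hx with rfl | hx
        · exact hA
        · exact hx.1.2
      · intro x hx
        simp only [Finset.mem_insert, Finset.mem_filter, Finset.mem_erase] at hx
        rcases hx with rfl | hx
        · exact ⟨inf_le_right, le_sup_left⟩
        · exact ⟨hx.2 ▸ inf_le_left, inW x hx.1.2⟩
    rw [Finset.card_insert_of_notMem (by simp)] at h3
    omega
  have himg : ((S.erase A).image (fun L => L ⊓ A)).card ≤ r + 1 + 1 := by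
    refine star hq hP _ K A _ _ _ hK (hS A hA).2 ?_ (hS A hA).1 ?_
    · intro X hX
      obtain ⟨L0, hL0, rfl⟩ := Finset.mem_image.1 hX
      have hL0' := Finset.mem_erase.1 hL0
      exact ⟨le_inf (hS _ hL0'.2).1 (hS A hA).1, inf_le_right, pt L0 hL0'.2 A hA hL0'.1⟩
    · rw [hsubt]; ring
  have := Finset.card_erase_add_one hA
  have h5 := Nat.mul_le_mul_left (r + 1) himg
  nlinarith

/-- fibre over fixed `U ⊔ K`, `U ⊓ K`. -/
lemma fib (K L P : Submodule R M) (c : ℕ) (hK : Nat.card K = c * q) (hPc : Nat.card P = c)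
    (hL : Nat.card L = c * q ^ 3) (hPK : P ≤ K)
    (hKL : K ≤ L)
    (S : Finset (Submodule R M)) (hS : ∀ U ∈ S, U ⊔ K = L ∧ U ⊓ K = P) : S.card ≤ q ^ 2 := by
  classical
  have c0 : 0 < c := hPc ▸ Nat.card_pos
  have q0 : 0 < q := by omega
  have cq : Nat.card (K ⧸ P.submoduleOf K) = q := by
    have := card_rel hPK
    rw [hK, hPc] at this
    exact (Nat.eq_of_mul_eq_mul_left c0 this).symm
  obtain ⟨w1, w2, hw1, hw2, hw⟩ : ∃ w1 w2, w1 ∈ L ∧ w2 ∈ L ∧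
      L ≤ R ∙ w1 ⊔ (R ∙ w2 ⊔ K) := by
    have h1 : K < L := lt_of_le_of_ne hKL fun h => by
      rw [← h, hK] at hL
      have : c * q * 1 < c * q * (q * q) :=
        Nat.mul_lt_mul_of_pos_left (by nlinarith) (Nat.mul_pos c0 q0)
      nlinarith
    obtain ⟨w2, hw2, hn2⟩ := SetLike.exists_of_lt h1
    have h2 : R ∙ w2 ⊔ K ≤ L := sup_le (by simpa using hw2) hKL
    by_cases he : R ∙ w2 ⊔ K = L
    · exact ⟨w2, w2, hw2, hw2, by rw [he]; exact le_sup_right⟩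
    obtain ⟨w1, hw1, hn1⟩ := SetLike.exists_of_lt (lt_of_le_of_ne h2 he)
    refine ⟨w1, w2, hw1, hw2, ?_⟩
    have h3 : K < R ∙ w2 ⊔ K := lt_of_le_of_ne le_sup_right fun h =>
      hn2 (h ▸ (le_sup_left : R ∙ w2 ≤ _) (Submodule.mem_span_singleton_self w2))
    have h4 : R ∙ w2 ⊔ K < R ∙ w1 ⊔ (R ∙ w2 ⊔ K) := lt_of_le_of_ne le_sup_right fun h =>
      hn1 (h ▸ (le_sup_left : R ∙ w1 ≤ _) (Submodule.mem_span_singleton_self w1))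
    have h5 := step hq hP h3
    have h6 := step hq hP h4
    refine (eq_of_card (sup_le (by simpa using hw1) h2) ?_).ge
    rw [hL]
    rw [hK] at h5
    have := Nat.mul_le_mul_right q h5
    nlinarith
  have ex : ∀ U ∈ S, ∀ w ∈ L, ∃ k : K, w + k ∈ U := by
    intro U hU w hw
    rw [← (hS U hU).1] at hw
    obtain ⟨u, hu, k, hk, rfl⟩ := Submodule.mem_sup.1 hw
    exact ⟨-⟨k, hk⟩, by simpa using hu⟩
  have ex1 : ∀ U, ∃ k : K, U ∈ S → w1 + k ∈ U := fun U => by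
    by_cases h : U ∈ S
    · obtain ⟨k, hk⟩ := ex U h w1 hw1
      exact ⟨k, fun _ => hk⟩
    · exact ⟨0, fun h' => absurd h' h⟩
  have ex2 : ∀ U, ∃ k : K, U ∈ S → w2 + k ∈ U := fun U => by
    by_cases h : U ∈ S
    · obtain ⟨k, hk⟩ := ex U h w2 hw2
      exact ⟨k, fun _ => hk⟩
    · exact ⟨0, fun h' => absurd h' h⟩
  choose f hf using ex1
  choose g hg using ex2
  let φ : S → (K ⧸ P.submoduleOf K) × (K ⧸ P.submoduleOf K) :=
    fun U => (Submodule.Quotient.mk (f U), Submodule.Quotient.mk (g U))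
  have main : ∀ U V : S, φ U = φ V → U.1 ≤ V.1 := by
    intro U V h x hx
    have e1 := (Submodule.Quotient.eq _).1 (congrArg Prod.fst h)
    have e2 := (Submodule.Quotient.eq _).1 (congrArg Prod.snd h)
    simp only [Submodule.submoduleOf, Submodule.mem_comap, Submodule.subtype_apply,
      Submodule.coe_sub] at e1 e2
    have hPV : P ≤ V.1 := (hS V V.2).2 ▸ inf_le_left
    have a1 : w1 + f U ∈ V.1 := by
      have := V.1.add_mem (hf V V.2) (hPV e1)
      convert this using 1; abel
    have a2 : w2 + g U ∈ V.1 := by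
      have := V.1.add_mem (hg V V.2) (hPV e2)
      convert this using 1; abel
    have hxL : x ∈ L := (hS U U.2).1 ▸ (le_sup_left : U.1 ≤ U.1 ⊔ K) hx
    obtain ⟨y, hy, z, hz, rfl⟩ := Submodule.mem_sup.1 (hw hxL)
    obtain ⟨y', hy', k, hk, rfl⟩ := Submodule.mem_sup.1 hz
    obtain ⟨a, rfl⟩ := Submodule.mem_span_singleton.1 hy
    obtain ⟨b, rfl⟩ := Submodule.mem_span_singleton.1 hy'
    have e : a • w1 + (b • w2 + k) = (a • (w1 + f U) + b • (w2 + g U)) +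
        (k - a • (f U : M) - b • (g U : M)) := by
      simp only [smul_add]; abel
    have hr : k - a • (f U : M) - b • (g U : M) ∈ P := by
      rw [← (hS U U.2).2]
      refine ⟨?_, ?_⟩
      · have := U.1.sub_mem hx (U.1.add_mem (U.1.smul_mem a (hf U U.2)) (U.1.smul_mem b (hg U U.2)))
        rw [e] at this
        simpa using this
      · exact K.sub_mem (K.sub_mem hk (K.smul_mem _ (f U).2)) (K.smul_mem _ (g U).2)
    rw [e]
    exact V.1.add_mem (V.1.add_mem (V.1.smul_mem _ a1) (V.1.smul_mem _ a2)) (hPV hr)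
  have inj : Function.Injective φ := fun U V h =>
    Subtype.ext (le_antisymm (main U V h) (main V U h.symm))
  have : Finite (K ⧸ P.submoduleOf K) := Finite.of_surjective _ (Submodule.mkQ_surjective _)
  have := Nat.card_le_card_of_injective φ inj
  rw [Nat.card_prod, cq] at this
  simpa [pow_two] using this

end abs

lemma card_pow {R : Type*} [Ring R] (N : Ideal R) (hmax : ∀ I : Ideal R, I.IsMaximal → I = N)
    (q : ℕ) (hq : Nat.card (R ⧸ N) = q) (n : ℕ) : ∀ (X : Type _) [AddCommGroup X] [Module R X] [Finite X],
    Nat.card X ≤ n → ∃ k, Nat.card X = q ^ k := by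
  induction n with
  | zero =>
    intro X _ _ _ h
    have : 0 < Nat.card X := Nat.card_pos
    omega
  | succ n ih =>
    intro X _ _ _ h
    rcases subsingleton_or_nontrivial X with hs | hs
    · exact ⟨0, by simp⟩
    · obtain ⟨A, hA⟩ := IsAtomic.exists_atom (Submodule R X)
      have : IsSimpleModule R A := isSimpleModule_iff_isAtom.2 hA
      obtain ⟨I, hI, ⟨e⟩⟩ := isSimpleModule_iff_quot_maximal.1 this
      have hI' := hmax I hI
      subst hI'
      have cA : Nat.card A = q := by rw [← hq]; exact Nat.card_congr e.toEquiv
      have hc := Submodule.card_eq_card_quotient_mul_card A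
      have : Finite (X ⧸ A) := Finite.of_surjective _ (Submodule.mkQ_surjective A)
      have hA1 : 1 < Nat.card A := by
        have : Nontrivial A := Submodule.nontrivial_iff_ne_bot.2 hA.1
        exact Finite.one_lt_card
      have hp : 0 < Nat.card (X ⧸ A) := Nat.card_pos
      obtain ⟨k, hk⟩ := ih (X ⧸ A) (by nlinarith)
      exact ⟨k + 1, by rw [hc, cA, hk]; ring⟩

end LS

theorem line_stripes_first_bound (q : ℕ) {R : Type*} [Ring R] [Fintype R]
    (hchain : ∀ I J : Ideal R, I ≤ J ∨ J ≤ I)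
    (N : Ideal R) (hN : N.IsMaximal)
    (hN2 : ∀ a ∈ N, ∀ b ∈ N, a * b = 0) (hNne : N ≠ ⊥)
    (hq : Nat.card (R ⧸ N) = q) (hq' : IsPrimePow q)
    (𝓕 : Finset (Submodule R (Fin 4 → R)))
    (hshape : ∀ U ∈ 𝓕, Nonempty (U ≃ₗ[R] ((Fin 2 → R) × (R ⧸ N))))
    (hint : ∀ U ∈ 𝓕, ∀ U' ∈ 𝓕, ∃ P : Submodule R (Fin 4 → R),
      P ≤ U ⊓ U' ∧ Nonempty (P ≃ₗ[R] R)) :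
    𝓕.card ≤ q ^ 2 * (q + 1) * (q ^ 2 + q + 1) := by
  classical
  have q2 : 2 ≤ q := hq'.two_le
  have hmax : ∀ I : Ideal R, I.IsMaximal → I = N := by
    intro I hI
    rcases hchain I N with h | h
    · exact hI.eq_of_le hN.ne_top h
    · exact (hN.eq_of_le hI.ne_top h).symm
  have hP : ∀ A : Submodule R (Fin 4 → R), ∃ k, Nat.card A = q ^ k := fun A =>
    LS.card_pow N hmax q hq _ A le_rfl
  -- units
  have hunit : ∀ r, r ∉ N → ∃ s, s * r = 1 ∧ r * s = 1 := by
    intro r hr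
    have h1 : N ≤ Ideal.span {r} := by
      rcases hchain N (Ideal.span {r}) with h | h
      · exact h
      · exact absurd (h (Ideal.subset_span rfl)) hr
    have h2 : Ideal.span {r} = ⊤ := by
      by_contra hne
      exact hr ((hN.eq_of_le hne h1) ▸ Ideal.subset_span rfl)
    obtain ⟨s, hs⟩ := Submodule.mem_span_singleton.1 ((Ideal.eq_top_iff_one _).1 h2)
    exact ⟨s, hs, mul_eq_one_symm hs⟩
  obtain ⟨t, htN, ht0⟩ := Submodule.exists_mem_ne_zero_of_ne_bot hNne
  have hann : ∀ r, t * r = 0 ↔ r ∈ N := by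
    intro r
    refine ⟨fun h => ?_, hN2 t htN r⟩
    by_contra hr
    obtain ⟨s, -, hs⟩ := hunit r hr
    exact ht0 (by rw [← mul_one t, ← hs, ← mul_assoc, h, zero_mul])
  have htr : ∀ r, t * r ∈ N := by
    intro r
    rw [← hann, ← mul_assoc, hN2 t htN t htN, zero_mul]
  -- card N
  have cNx : ∀ n ∈ N, n ≠ 0 → Nat.card (Ideal.span {n}) = q := by
    intro n hn h0
    have hk : LinearMap.ker (LinearMap.toSpanSingleton R R n) = N := by
      symm
      apply hN.eq_of_le
      · rw [Ne, Ideal.eq_top_iff_one]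
        simpa using h0
      · intro r hr
        simpa using hN2 r hr n hn
    have e := (LinearMap.toSpanSingleton R R n).quotKerEquivRange
    rw [hk, LinearMap.range_toSpanSingleton] at e
    rw [← hq]
    exact (Nat.card_congr e.toEquiv).symm
  have cN : Nat.card N = q := by
    have : N = Ideal.span {t} := by
      apply le_antisymm
      · intro n hn
        by_cases h0 : n = 0
        · simp [h0]
        have c1 := cNx n hn h0
        have c2 := cNx t htN ht0
        have : Ideal.span {n} = Ideal.span {t} := by
          rcases hchain (Ideal.span {n}) (Ideal.span {t}) with h | h
          · exact LS.eq_of_card h (by rw [c1, c2])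
          · exact (LS.eq_of_card h (by rw [c1, c2])).symm
        exact this ▸ Ideal.subset_span rfl
      · simpa [Ideal.span_le] using htN
    rw [this]
    exact cNx t htN ht0
  have cR : Nat.card R = q ^ 2 := by
    rw [Submodule.card_eq_card_quotient_mul_card N, cN, hq, pow_two]
  have cM : Nat.card (Fin 4 → R) = q ^ 4 * q ^ 4 := by
    rw [Nat.card_fun, cR, Nat.card_fin]; ring
  -- every element of N is t * r
  have hright : ∀ n ∈ N, ∃ r, n = t * r := by
    let f : R →+ R := AddMonoidHom.mulLeft t
    have hk : (f.ker : Set R) = N := by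
      ext r; simp [f, AddMonoidHom.mem_ker, hann]
    have h1 : Nat.card R = Nat.card f.range * Nat.card f.ker := by
      rw [AddSubgroup.card_eq_card_quotient_mul_card_addSubgroup f.ker,
        Nat.card_congr (QuotientAddGroup.quotientKerEquivRange f).toEquiv]
    have h2 : Nat.card f.ker = q := by
      rw [← cN]
      exact congrArg Set.ncard hk
    rw [cR, h2, pow_two] at h1
    have h3 : Nat.card f.range = q := (Nat.eq_of_mul_eq_mul_right (by omega) h1).symm
    have h4 : (f.range : Set R) = N := by
      apply Set.eq_of_subset_of_ncard_le _ _ (Set.toFinite _)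
      · rintro _ ⟨r, rfl⟩
        exact htr r
      · exact (cN.trans h3.symm).le
    intro n hn
    have : n ∈ (f.range : Set R) := h4 ▸ hn
    obtain ⟨r, hr⟩ := this
    exact ⟨r, hr.symm⟩
  -- K
  let K : Submodule R (Fin 4 → R) := Submodule.pi Set.univ (fun _ => N)
  have memK : ∀ x, x ∈ K ↔ ∀ i, x i ∈ N := fun x => by simp [K, Submodule.mem_pi]
  have memK' : ∀ x, x ∈ K ↔ t • x = 0 := fun x => by
    rw [memK, funext_iff]
    exact forall_congr' fun i => (hann (x i)).symm
  have tK : ∀ x : Fin 4 → R, t • x ∈ K := fun x => (memK _).2 fun i => htr (x i)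
  have cK : Nat.card K = q ^ 4 := by
    have e : K ≃ (Fin 4 → N) :=
      { toFun := fun x i => ⟨x.1 i, (memK _).1 x.2 i⟩
        invFun := fun y => ⟨fun i => y i, (memK _).2 fun i => (y i).2⟩
        left_inv := fun x => rfl
        right_inv := fun y => rfl }
    rw [Nat.card_congr e, Nat.card_fun, cN, Nat.card_fin]
  -- stripes
  have cU : ∀ U ∈ 𝓕, Nat.card U = q ^ 5 := by
    intro U hU
    obtain ⟨e⟩ := hshape U hU
    rw [Nat.card_congr e.toEquiv, Nat.card_prod, Nat.card_fun, cR, hq, Nat.card_fin]; ring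
  have cUK : ∀ U ∈ 𝓕, Nat.card (U ⊓ K : Submodule R (Fin 4 → R)) = q ^ 3 := by
    intro U hU
    obtain ⟨e⟩ := hshape U hU
    have tz : ∀ z : R ⧸ N, t • z = 0 := by
      intro z
      obtain ⟨r, rfl⟩ := Submodule.Quotient.mk_surjective _ z
      rw [← Submodule.Quotient.mk_smul, Submodule.Quotient.mk_eq_zero]
      exact htr r
    have key : ∀ u : U, (u : Fin 4 → R) ∈ K ↔ ∀ i, (e u).1 i ∈ N := by
      intro u
      rw [memK']
      have : t • (u : Fin 4 → R) = 0 ↔ t • e u = 0 := by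
        rw [← map_smul, LinearEquiv.map_eq_zero_iff, ← Submodule.coe_smul, Submodule.coe_eq_zero]
      rw [this, Prod.ext_iff]
      simp only [Prod.smul_fst, Prod.smul_snd, Prod.fst_zero, Prod.snd_zero, tz, and_true]
      rw [funext_iff]
      exact forall_congr' fun i => hann _
    have E : (U ⊓ K : Submodule R (Fin 4 → R)) ≃ (Fin 2 → N) × (R ⧸ N) :=
      { toFun := fun x => (fun i => ⟨(e ⟨x.1, x.2.1⟩).1 i, (key ⟨x.1, x.2.1⟩).1 x.2.2 i⟩,
          (e ⟨x.1, x.2.1⟩).2)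
        invFun := fun y => ⟨(e.symm (fun i => (y.1 i : R), y.2) : U),
          (e.symm (fun i => (y.1 i : R), y.2) : U).2, (key _).2 fun i => by simp⟩
        left_inv := fun x => by
          apply Subtype.ext
          simp
        right_inv := fun y => by
          simp }
    rw [Nat.card_congr E, Nat.card_prod, Nat.card_fun, cN, hq, Nat.card_fin]; ring
  have q0 : 0 < q := by omega
  have cL : ∀ U ∈ 𝓕, Nat.card (U ⊔ K : Submodule R (Fin 4 → R)) = q ^ 4 * q ^ 2 := by
    intro U hU
    have := LS.card_sup_inf U K
    rw [cUK U hU, cU U hU, cK] at this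
    apply Nat.eq_of_mul_eq_mul_right (pow_pos q0 3)
    rw [this]; ring
  have hlines : (𝓕.image fun U => U ⊔ K).card ≤ q ^ 2 + q + 1 := by
    refine LS.ekr q2 hP K (q ^ 4) cK cM _ ?_ ?_
    · intro L hL
      obtain ⟨U, hU, rfl⟩ := Finset.mem_image.1 hL
      exact ⟨le_sup_right, cL U hU⟩
    · intro L hL L' hL'
      obtain ⟨U, hU, rfl⟩ := Finset.mem_image.1 hL
      obtain ⟨U', hU', rfl⟩ := Finset.mem_image.1 hL'
      obtain ⟨P, hPU, ⟨e⟩⟩ := hint U hU U' hU'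
      refine lt_of_le_of_ne (le_inf le_sup_right le_sup_right) fun h => ?_
      have hPK : P ≤ K := by
        rw [h]
        exact hPU.trans (inf_le_inf le_sup_left le_sup_left)
      have h1 := (memK' _).1 (hPK (e.symm 1).2)
      rw [← Submodule.coe_smul, Submodule.coe_eq_zero, ← map_smul, LinearEquiv.map_eq_zero_iff] at h1
      exact ht0 (by simpa using h1)
  have hfib : 𝓕.card ≤ (q ^ 2 * (q + 1)) * (𝓕.image fun U => U ⊔ K).card := by
    apply Finset.card_le_mul_card_image
    intro L hL
    obtain ⟨U0, hU0, rfl⟩ := Finset.mem_image.1 hL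
    set L := U0 ⊔ K with hLdef
    have cL0 := cL U0 hU0
    rw [← hLdef] at cL0
    set G := 𝓕.filter fun U => U ⊔ K = L with hG
    have hpl : (G.image fun U => U ⊓ K).card ≤ q + 1 := by
      let D : Submodule R (Fin 4 → R) :=
        { carrier := {y | ∃ x ∈ L, y = t • x}
          add_mem' := by
            rintro _ _ ⟨x, hx, rfl⟩ ⟨y, hy, rfl⟩
            exact ⟨x + y, L.add_mem hx hy, by rw [smul_add]⟩
          zero_mem' := ⟨0, L.zero_mem, by simp⟩
          smul_mem' := by
            rintro r _ ⟨x, hx, rfl⟩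
            obtain ⟨s, hs⟩ := hright (r * t) (N.mul_mem_left r htN)
            exact ⟨s • x, L.smul_mem _ hx, by rw [smul_smul, smul_smul, hs]⟩ }
      have DK : D ≤ K := by
        rintro _ ⟨x, hx, rfl⟩
        exact tK x
      have cD : Nat.card D = q ^ 2 := by
        let f : L →+ (Fin 4 → R) :=
          { toFun := fun x => t • (x : Fin 4 → R)
            map_zero' := by simp
            map_add' := fun x y => by simp }
        have h1 : Nat.card L = Nat.card f.range * Nat.card f.ker := by
          rw [AddSubgroup.card_eq_card_quotient_mul_card_addSubgroup f.ker,
            Nat.card_congr (QuotientAddGroup.quotientKerEquivRange f).toEquiv]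
        have h2 : (f.range : Set (Fin 4 → R)) = D := by
          ext y
          constructor
          · rintro ⟨x, rfl⟩
            exact ⟨x, x.2, rfl⟩
          · rintro ⟨x, hx, rfl⟩
            exact ⟨⟨x, hx⟩, rfl⟩
        have h2' : Nat.card f.range = Nat.card D := congrArg Set.ncard h2
        have h3 : Nat.card f.ker = Nat.card K := by
          refine Nat.card_congr
            { toFun := fun x => ⟨x.1.1, (memK' _).2 x.2⟩
              invFun := fun y => ⟨⟨y.1, (le_sup_right : K ≤ U0 ⊔ K) y.2⟩, (memK' _).1 y.2⟩
              left_inv := fun x => rfl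
              right_inv := fun y => rfl }
        rw [h2', h3, cK, cL0, mul_comm] at h1
        exact (Nat.eq_of_mul_eq_mul_right (pow_pos q0 4) h1).symm
      refine LS.star q2 hP _ D K _ _ _ cD cK ?_ DK ?_
      · intro X hX
        obtain ⟨U, hU, rfl⟩ := Finset.mem_image.1 hX
        obtain ⟨hU, hUL⟩ := Finset.mem_filter.1 hU
        refine ⟨le_inf ?_ DK, inf_le_right, ?_⟩
        · rintro _ ⟨x, hx, rfl⟩
          rw [← hUL] at hx
          obtain ⟨u, hu, k, hk, rfl⟩ := Submodule.mem_sup.1 hx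
          rw [smul_add, (memK' k).1 hk, add_zero]
          exact U.smul_mem _ hu
        · rw [cUK U hU]; ring
      · obtain ⟨r, rfl⟩ : ∃ r, q = r + 1 := ⟨q - 1, by omega⟩
        have : (r + 1) ^ 2 * (r + 1) - (r + 1) ^ 2 = (r + 1) ^ 2 * r := by
          rw [mul_add, mul_one, Nat.add_sub_cancel]
        rw [this]; ring
    have h2 : G.card ≤ q ^ 2 * (G.image fun U => U ⊓ K).card := by
      apply Finset.card_le_mul_card_image
      intro P hPm
      obtain ⟨U1, hU1, rfl⟩ := Finset.mem_image.1 hPm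
      obtain ⟨hU1, hUL1⟩ := Finset.mem_filter.1 hU1
      refine LS.fib q2 hP K L (U1 ⊓ K) (q ^ 3) (by rw [cK]; ring) (cUK U1 hU1)
        (by rw [cL0]; ring) inf_le_right le_sup_right _ ?_
      intro U hU
      obtain ⟨hU, h⟩ := Finset.mem_filter.1 hU
      exact ⟨(Finset.mem_filter.1 hU).2, h⟩
    exact h2.trans (Nat.mul_le_mul_left _ hpl)
  exact hfib.trans (Nat.mul_le_mul_left _ hlines)
end

section
/- Let R be a finite chain ring of length 2 with maximal ideal N and residue field F_q. Let 𝓕 be a family of submodules of R^4, each isomorphic to R ⊕ R ⊕ R/N (shape (2,2,1)), such that any two members of 𝓕 contain a common free rank-1 submodule. Then |𝓕| ≤ q(q²+1)(q²+q+1). -/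
section Geo
variable {K V : Type*} [DivisionRing K] [Finite K] [AddCommGroup V] [Module K V] [FiniteDimensional K V]

lemma aux_card (W : Submodule K V) : (W : Set V).ncard = Nat.card K ^ Module.finrank K W := by
  rw [← Module.natCard_eq_pow_finrank (K := K) (V := W)]; rfl

lemma aux_diff (P W : Submodule K V) (h : P ≤ W) :
    ((W : Set V) \ P).ncard = Nat.card K ^ Module.finrank K W - Nat.card K ^ Module.finrank K P := by
  have : Finite V := Module.finite_of_finite K
  rw [Set.ncard_sdiff (by exact h) (Set.toFinite _), aux_card, aux_card]

lemma aux_count (P Q : Submodule K V) (hPQ : P ≤ Q) (S : Finset (Submodule K V)) (d m : ℕ)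
    (hS : ∀ W ∈ S, P ≤ W ∧ W ≤ Q ∧ Module.finrank K W = d)
    (hm : ∀ v ∈ Q, v ∉ P → ∀ S' ⊆ S, (∀ W ∈ S', v ∈ W) → S'.card ≤ m) :
    S.card * (Nat.card K ^ d - Nat.card K ^ Module.finrank K P) ≤
    (Nat.card K ^ Module.finrank K Q - Nat.card K ^ Module.finrank K P) * m := by
  classical
  have : Finite V := Module.finite_of_finite K
  have : Fintype V := Fintype.ofFinite V
  rw [← aux_diff P Q hPQ, Set.ncard_eq_toFinset_card']
  refine Finset.card_mul_le_card_mul (fun (W : Submodule K V) (v : V) => v ∈ W) ?_ ?_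
  · intro W hW
    obtain ⟨h1, h2, h3⟩ := hS W hW
    rw [← h3, ← aux_diff P W h1, Set.ncard_eq_toFinset_card']
    apply Finset.card_le_card
    intro v hv
    simp [Finset.bipartiteAbove] at hv ⊢
    exact ⟨⟨h2 hv.1, hv.2⟩, hv.1⟩
  · intro v hv
    simp at hv
    apply hm v hv.1 hv.2
    · exact Finset.filter_subset _ _
    · intro W hW
      simp [Finset.bipartiteBelow] at hW
      exact hW.2

lemma aux_q : 2 ≤ Nat.card K := Finite.one_lt_card

lemma aux_arith1 {q n : ℕ} (hq : 2 ≤ q) (a : ℕ) (h : n * (q ^ (a+2) - q ^ (a+1)) ≤ (q^(a+3) - q^(a+1)) * 1) :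
    n ≤ q + 1 := by
  have e1 : q ^ (a+2) - q ^ (a+1) = q ^ (a+1) * (q - 1) := by
    rw [Nat.mul_sub, mul_one]; ring_nf
  have e2 : q ^ (a+3) - q ^ (a+1) = (q + 1) * (q ^ (a+1) * (q - 1)) := by
    obtain ⟨k, rfl⟩ : ∃ k, q = k + 1 := ⟨q - 1, by omega⟩
    rw [Nat.sub_eq_iff_eq_add (Nat.pow_le_pow_right (by omega) (by omega))]
    simp only [Nat.add_sub_cancel]; ring
  rw [e1, mul_one, e2] at h
  exact Nat.le_of_mul_le_mul_right h (Nat.mul_pos (by positivity) (by omega))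

lemma aux_arith2 {q n : ℕ} (hq : 2 ≤ q) (a : ℕ) (h : n * (q ^ (a+2) - q ^ a) ≤ (q^(a+3) - q^a) * (q+1)) :
    n ≤ q ^ 2 + q + 1 := by
  obtain ⟨k, rfl⟩ : ∃ k, q = k + 1 := ⟨q - 1, by omega⟩
  have e1 : (k+1) ^ (a+2) - (k+1) ^ a = (k+1) ^ a * (k * (k+2)) := by
    rw [Nat.sub_eq_iff_eq_add (Nat.pow_le_pow_right (by omega) (by omega))]
    ring
  have e2 : ((k+1) ^ (a+3) - (k+1) ^ a) * (k + 1 + 1) = ((k+1)^2 + (k+1) + 1) * ((k+1) ^ a * (k * (k+2))) := by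
    have : (k+1) ^ (a+3) - (k+1) ^ a = (k+1)^a * (k * ((k+1)^2 + (k+1) + 1)) := by
      rw [Nat.sub_eq_iff_eq_add (Nat.pow_le_pow_right (by omega) (by omega))]
      ring
    rw [this]; ring
  rw [e1, e2] at h
  exact Nat.le_of_mul_le_mul_right h (Nat.mul_pos (by positivity) (Nat.mul_pos (by omega) (by omega)))

/-- subspaces of dim a+2 between dims a+1 and a+3 -/
lemma aux_pencil (P Q : Submodule K V) (hPQ : P ≤ Q) (a : ℕ) (hP : Module.finrank K P = a + 1)
    (hQ : Module.finrank K Q = a + 3) (S : Finset (Submodule K V))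
    (hS : ∀ W ∈ S, P ≤ W ∧ W ≤ Q ∧ Module.finrank K W = a + 2) : S.card ≤ Nat.card K + 1 := by
  have h := aux_count P Q hPQ S (a+2) 1 hS ?_
  · rw [hP, hQ] at h
    exact aux_arith1 aux_q a h
  intro v hv hvP S' hS' hvS
  rw [Finset.card_le_one]
  have key : ∀ W ∈ S', P ⊔ K ∙ v = W := by
    intro W hW
    obtain ⟨h1, h2, h3⟩ := hS W (hS' hW)
    have hlt : P < P ⊔ K ∙ v := by
      refine lt_of_le_of_ne le_sup_left fun h => hvP ?_
      rw [h]; exact Submodule.mem_sup_right (Submodule.mem_span_singleton_self v)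
    apply Submodule.eq_of_le_of_finrank_le
    · exact sup_le h1 (by simpa using hvS W hW)
    · have := Submodule.finrank_lt_finrank_of_lt hlt
      omega
  intro A hA B hB
  rw [← key A hA, ← key B hB]

/-- subspaces of dim a+2 between dims a and a+3 -/
lemma aux_plane (P Q : Submodule K V) (hPQ : P ≤ Q) (a : ℕ) (hP : Module.finrank K P = a)
    (hQ : Module.finrank K Q = a + 3) (S : Finset (Submodule K V))
    (hS : ∀ W ∈ S, P ≤ W ∧ W ≤ Q ∧ Module.finrank K W = a + 2) :
    S.card ≤ Nat.card K ^ 2 + Nat.card K + 1 := by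
  have h := aux_count P Q hPQ S (a+2) (Nat.card K + 1) hS ?_
  · rw [hP, hQ] at h
    exact aux_arith2 aux_q a h
  intro v hv hvP S' hS' hvS
  have hlt : P < P ⊔ K ∙ v := by
    refine lt_of_le_of_ne le_sup_left fun h => hvP ?_
    rw [h]; exact Submodule.mem_sup_right (Submodule.mem_span_singleton_self v)
  have h1 := Submodule.finrank_lt_finrank_of_lt hlt
  have h2 := Submodule.finrank_add_le_finrank_add_finrank P (K ∙ v)
  have h3 : Module.finrank K (K ∙ v) ≤ 1 := (finrank_span_singleton (K := K) (fun h0 => hvP (h0 ▸ P.zero_mem) : v ≠ 0)).le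
  refine aux_pencil (P ⊔ K ∙ v) Q (sup_le hPQ (by simpa using hv)) a (by omega) hQ S' ?_
  intro W hW
  obtain ⟨h1, h2, h3⟩ := hS W (hS' hW)
  exact ⟨sup_le h1 (by simpa using hvS W hW), h2, h3⟩

lemma aux_inf_one (A B : Submodule K V) (hA : Module.finrank K A = 2) (hB : Module.finrank K B = 2)
    (hne : A ≠ B) (p : V) (hp : p ≠ 0) (hpA : p ∈ A) (hpB : p ∈ B) : A ⊓ B = K ∙ p := by
  symm
  apply Submodule.eq_of_le_of_finrank_le
  · simp [hpA, hpB]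
  · rw [finrank_span_singleton hp]
    by_contra hcon
    push Not at hcon
    apply hne
    have h1 : A ⊓ B = A := Submodule.eq_of_le_of_finrank_le inf_le_left (by omega)
    have h2 : A ⊓ B = B := Submodule.eq_of_le_of_finrank_le inf_le_right (by omega)
    rw [← h1, h2]

lemma aux_lines (S : Set (Submodule K V)) (hne : S.Nonempty) (hd : ∀ L ∈ S, Module.finrank K L = 2)
    (hint : ∀ A ∈ S, ∀ B ∈ S, ∃ p : V, p ≠ 0 ∧ p ∈ A ∧ p ∈ B) :
    (∃ p : V, p ≠ 0 ∧ ∀ L ∈ S, p ∈ L) ∨ ∃ Q : Submodule K V, Module.finrank K Q = 3 ∧ ∀ L ∈ S, L ≤ Q := by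
  by_cases hall : ∀ A ∈ S, ∀ B ∈ S, A = B
  · left
    obtain ⟨A, hA⟩ := hne
    obtain ⟨p, hp, h1, h2⟩ := hint A hA A hA
    exact ⟨p, hp, fun L hL => hall A hA L hL ▸ h1⟩
  push Not at hall
  obtain ⟨A, hA, B, hB, hAB⟩ := hall
  obtain ⟨p, hp, hpA, hpB⟩ := hint A hA B hB
  have hinf := aux_inf_one A B (hd A hA) (hd B hB) hAB p hp hpA hpB
  by_cases hpall : ∀ L ∈ S, p ∈ L
  · exact Or.inl ⟨p, hp, hpall⟩
  right
  push Not at hpall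
  obtain ⟨C, hC, hpC⟩ := hpall
  have hpmem : ∀ x, x ≠ 0 → x ∈ A → x ∈ B → ∀ D : Submodule K V, x ∈ D → p ∈ D := by
    intro x hx hxA hxB D hxD
    have : x ∈ K ∙ p := hinf ▸ (⟨hxA, hxB⟩ : x ∈ A ⊓ B)
    obtain ⟨c, rfl⟩ := Submodule.mem_span_singleton.1 this
    have hc : c ≠ 0 := by rintro rfl; simp at hx
    have := D.smul_mem c⁻¹ hxD
    rwa [smul_smul, inv_mul_cancel₀ hc, one_smul] at this
  refine ⟨A ⊔ B, ?_, ?_⟩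
  · have := Submodule.finrank_sup_add_finrank_inf_eq A B
    rw [hinf, finrank_span_singleton hp, hd A hA, hd B hB] at this
    omega
  -- two distinct points of a line in the plane give inclusion
  have two : ∀ D ∈ S, ∀ a b : V, a ≠ 0 → b ≠ 0 → a ∈ D → b ∈ D → a ∈ A ⊔ B → b ∈ A ⊔ B →
      b ∉ K ∙ a → D ≤ A ⊔ B := by
    intro D hD a b ha hb haD hbD haQ hbQ hab
    have hlt : K ∙ a < D ⊓ (A ⊔ B) := by
      refine lt_of_le_of_ne (by simp only [Submodule.span_singleton_le_iff_mem]; exact ⟨haD, haQ⟩) ?_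
      intro h; exact hab (h ▸ ⟨hbD, hbQ⟩)
    have h1 := Submodule.finrank_lt_finrank_of_lt hlt
    rw [finrank_span_singleton ha] at h1
    have : D ⊓ (A ⊔ B) = D := Submodule.eq_of_le_of_finrank_le inf_le_left (by rw [hd D hD]; omega)
    rw [← this]; exact inf_le_right
  intro D hD
  obtain ⟨a, ha, haD, haA⟩ := hint D hD A hA
  obtain ⟨b, hb, hbD, hbB⟩ := hint D hD B hB
  by_cases hab : b ∈ K ∙ a
  · -- then b ∈ A, D contains p
    have hbA : b ∈ A := (by simpa using haA : K ∙ a ≤ A) hab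
    have hpD := hpmem b hb hbA hbB D hbD
    obtain ⟨c, hc, hcD, hcC⟩ := hint D hD C hC
    have hCQ : C ≤ A ⊔ B := by
      obtain ⟨a, ha, haC, haA⟩ := hint C hC A hA
      obtain ⟨b, hb, hbC, hbB⟩ := hint C hC B hB
      refine two C hC a b ha hb haC hbC (Submodule.mem_sup_left haA) (Submodule.mem_sup_right hbB) ?_
      intro hab
      exact hpC (hpmem b hb ((by simpa using haA : K ∙ a ≤ A) hab) hbB C hbC)
    refine two D hD c p hc hp hcD hpD (hCQ hcC) (Submodule.mem_sup_left hpA) ?_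
    intro h
    exact hpC ((by simpa using hcC : K ∙ c ≤ C) h)
  · exact two D hD a b ha hb haD hbD (Submodule.mem_sup_left haA) (Submodule.mem_sup_right hbB) hab

/-- The combinatorial core. -/
lemma aux_core {α : Type*} (hV : Module.finrank K V = 4) (F : Finset α) (L W : α → Submodule K V)
    (agr : V → α → α → Prop)
    (hL : ∀ U ∈ F, Module.finrank K (L U) = 2) (hW : ∀ U ∈ F, Module.finrank K (W U) = 3)
    (hLW : ∀ U ∈ F, L U ≤ W U)
    (hint : ∀ U ∈ F, ∀ U' ∈ F, ∃ p, p ≠ 0 ∧ p ∈ L U ∧ p ∈ L U' ∧ agr p U U')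
    (hsmul : ∀ (c : K) p U U', agr p U U' → agr (c • p) U U')
    (htrans : ∀ p, ∀ U ∈ F, ∀ U' ∈ F, ∀ U'' ∈ F, W U = W U'' → W U' = W U'' →
      agr p U U'' → agr p U' U'' → agr p U U')
    (C1 : ∀ w l, ∀ G ⊆ F, (∀ U ∈ G, W U = w ∧ L U = l) → G.card ≤ Nat.card K ^ 2)
    (C2 : ∀ w l p, p ≠ 0 → p ∈ l → ∀ G ⊆ F, (∀ U ∈ G, W U = w ∧ L U = l) →
      (∀ U ∈ G, ∀ U' ∈ G, agr p U U') → G.card ≤ Nat.card K) :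
    F.card ≤ Nat.card K * (Nat.card K ^ 2 + 1) * (Nat.card K ^ 2 + Nat.card K + 1) := by
  classical
  have hq : 2 ≤ Nat.card K := aux_q
  set q := Nat.card K with hqdef
  -- Lemma A
  have lemA : ∀ w, ∀ G ⊆ F, (∀ U ∈ G, W U = w) → ∀ n, q ≤ n → (G.image L).card ≤ n → G.card ≤ q * n := by
    intro w G hG hGw n hn him
    by_cases hall : ∀ U ∈ G, ∀ U' ∈ G, L U = L U'
    · rcases G.eq_empty_or_nonempty with rfl | ⟨U0, hU0⟩
      · simp
      · have := C1 w (L U0) G hG (fun U hU => ⟨hGw U hU, hall U hU U0 hU0⟩)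
        nlinarith
    · push Not at hall
      obtain ⟨A, hA, B, hB, hAB⟩ := hall
      refine (Finset.card_le_mul_card_image (f := L) G q ?_).trans (Nat.mul_le_mul_left q him)
      intro l hl
      obtain ⟨U1, hU1, hU1l⟩ : ∃ U1 ∈ G, L U1 ≠ l := by
        by_cases h : L A = l
        · exact ⟨B, hB, fun h' => hAB (h.trans h'.symm)⟩
        · exact ⟨A, hA, h⟩
      obtain ⟨U0, hU0, hU0l⟩ := Finset.mem_image.1 hl
      obtain ⟨p, hp, hp0, hp1, -⟩ := hint U0 (hG hU0) U1 (hG hU1)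
      rw [hU0l] at hp0
      have hld : Module.finrank K l = 2 := hU0l ▸ hL U0 (hG hU0)
      have hinf := aux_inf_one l (L U1) hld (hL U1 (hG hU1)) hU1l.symm p hp hp0 hp1
      have hagr : ∀ U ∈ G, L U = l → agr p U U1 := by
        intro U hU hUl
        obtain ⟨x, hx, hxU, hxU1, hxa⟩ := hint U (hG hU) U1 (hG hU1)
        rw [hUl] at hxU
        have : x ∈ K ∙ p := hinf ▸ (⟨hxU, hxU1⟩ : x ∈ l ⊓ L U1)
        obtain ⟨c, rfl⟩ := Submodule.mem_span_singleton.1 this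
        have hc : c ≠ 0 := by rintro rfl; simp at hx
        have := hsmul c⁻¹ _ _ _ hxa
        rwa [smul_smul, inv_mul_cancel₀ hc, one_smul] at this
      apply C2 w l p hp hp0
      · exact (Finset.filter_subset _ _).trans hG
      · intro U hU
        simp at hU
        exact ⟨hGw U hU.1, hU.2⟩
      · intro U hU U' hU'
        simp at hU hU'
        exact htrans p U (hG hU.1) U' (hG hU'.1) U1 (hG hU1) (by rw [hGw U hU.1, hGw U1 hU1])
          (by rw [hGw U' hU'.1, hGw U1 hU1]) (hagr U hU.1 hU.2) (hagr U' hU'.1 hU'.2)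
  rcases F.eq_empty_or_nonempty with rfl | ⟨U0, hU0⟩
  · simp
  rcases aux_lines (L '' (F : Set α)) ⟨_, U0, hU0, rfl⟩ (by rintro _ ⟨U, hU, rfl⟩; exact hL U hU)
    (by
      rintro _ ⟨U, hU, rfl⟩ _ ⟨U', hU', rfl⟩
      obtain ⟨p, h1, h2, h3, -⟩ := hint U hU U' hU'
      exact ⟨p, h1, h2, h3⟩) with ⟨p, hp, hpL⟩ | ⟨Q, hQ, hLQ⟩
  · have hpL' : ∀ U ∈ F, p ∈ L U := fun U hU => hpL _ ⟨U, hU, rfl⟩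
    have hcard : (F.image W).card ≤ q ^ 2 + q + 1 := by
      refine aux_plane (K ∙ p) ⊤ le_top 1 (finrank_span_singleton hp) (by rw [finrank_top, hV]) _ ?_
      intro w hw
      obtain ⟨U, hU, rfl⟩ := Finset.mem_image.1 hw
      exact ⟨by simpa using hLW U hU (hpL' U hU), le_top, hW U hU⟩
    refine (Finset.card_le_mul_card_image (f := W) F (q * (q ^ 2 + 1)) ?_).trans
      (Nat.mul_le_mul_left _ hcard)
    intro w hw
    obtain ⟨U1, hU1, hU1w⟩ := Finset.mem_image.1 hw
    refine (lemA w _ (Finset.filter_subset _ _) (by intro U hU; simp at hU; exact hU.2) (q+1) (by omega) ?_).trans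
      (Nat.mul_le_mul_left _ (by nlinarith))
    refine aux_pencil (K ∙ p) w ?_ 0 (finrank_span_singleton hp) (hU1w ▸ hW U1 hU1) _ ?_
    · rw [← hU1w]; simpa using hLW U1 hU1 (hpL' U1 hU1)
    · intro l hl
      obtain ⟨U, hU, rfl⟩ := Finset.mem_image.1 hl
      simp at hU
      exact ⟨by simpa using hpL' U hU.1, hU.2 ▸ hLW U hU.1, hL U hU.1⟩
  · have hLQ' : ∀ U ∈ F, L U ≤ Q := fun U hU => hLQ _ ⟨U, hU, rfl⟩
    have hlines : ∀ G ⊆ F, (G.image L).card ≤ q ^ 2 + q + 1 := by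
      intro G hG
      refine aux_plane ⊥ Q bot_le 0 (finrank_bot K V) hQ _ ?_
      intro l hl
      obtain ⟨U, hU, rfl⟩ := Finset.mem_image.1 hl
      exact ⟨bot_le, hLQ' U (hG hU), hL U (hG hU)⟩
    have h1 : (F.filter (fun U => W U = Q)).card ≤ q * (q ^ 2 + q + 1) :=
      lemA Q _ (Finset.filter_subset _ _) (by intro U hU; simp at hU; exact hU.2) _ (by nlinarith)
        (hlines _ (Finset.filter_subset _ _))
    have h2 : (F.filter (fun U => ¬ W U = Q)).card ≤ (q * q ^ 2) * (q ^ 2 + q + 1) := by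
      refine (Finset.card_le_mul_card_image (f := L) _ (q * q ^ 2) ?_).trans
        (Nat.mul_le_mul_left _ (hlines _ (Finset.filter_subset _ _)))
      intro l hl
      obtain ⟨U1, hU1, hU1l⟩ := Finset.mem_image.1 hl
      simp at hU1
      set G := (F.filter (fun U => ¬ W U = Q)).filter (fun U => L U = l) with hG
      have hGm : ∀ U ∈ G, U ∈ F ∧ W U ≠ Q ∧ L U = l := by
        intro U hU; simp [hG] at hU; exact ⟨hU.1.1, hU.1.2, hU.2⟩
      have hpl : (insert Q (G.image W)).card ≤ q + 1 := by
        refine aux_pencil l ⊤ le_top 1 (hU1l ▸ hL U1 hU1.1) (by rw [finrank_top, hV]) _ ?_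
        intro w hw
        rcases Finset.mem_insert.1 hw with rfl | hw
        · exact ⟨hU1l ▸ hLQ' U1 hU1.1, le_top, hQ⟩
        · obtain ⟨U, hU, rfl⟩ := Finset.mem_image.1 hw
          obtain ⟨a, b, c⟩ := hGm U hU
          exact ⟨c ▸ hLW U a, le_top, hW U a⟩
      rw [Finset.card_insert_of_notMem (by
        intro h
        obtain ⟨U, hU, hUQ⟩ := Finset.mem_image.1 h
        exact (hGm U hU).2.1 hUQ)] at hpl
      rw [mul_comm q]
      refine (Finset.card_le_mul_card_image (f := W) G (q ^ 2) ?_).trans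
        (Nat.mul_le_mul_left _ (by omega))
      intro w hw
      apply C1 w l
      · intro U hU; exact (hGm U (Finset.mem_filter.1 hU).1).1
      · intro U hU; exact ⟨(Finset.mem_filter.1 hU).2, (hGm U (Finset.mem_filter.1 hU).1).2.2⟩
    have h3 := Finset.card_filter_add_card_filter_not (s := F) (fun U => W U = Q)
    nlinarith
end Geo

section Alg
variable {R K : Type*} [Ring R] [DivisionRing K] (ρ : R →+* K) (hρ : Function.Surjective ρ)
  (θ : R)

/-- reduction -/
def auxPi (x : Fin 4 → R) : Fin 4 → K := fun i => ρ (x i)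

lemma auxPi_add (x y : Fin 4 → R) : auxPi ρ (x + y) = auxPi ρ x + auxPi ρ y := by
  ext i; simp [auxPi]
lemma auxPi_sub (x y : Fin 4 → R) : auxPi ρ (x - y) = auxPi ρ x - auxPi ρ y := by
  ext i; simp [auxPi]
lemma auxPi_smul (r : R) (x : Fin 4 → R) : auxPi ρ (r • x) = ρ r • auxPi ρ x := by
  ext i; simp [auxPi]
include hρ in
lemma auxPi_surj : Function.Surjective (auxPi ρ) := by
  intro v
  choose f hf using hρ
  exact ⟨fun i => f (v i), by ext i; simp [auxPi, hf]⟩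

/-- image -/
def auxL (U : Submodule R (Fin 4 → R)) : Submodule K (Fin 4 → K) where
  carrier := {v | ∃ x ∈ U, auxPi ρ x = v}
  zero_mem' := ⟨0, U.zero_mem, by ext; simp [auxPi]⟩
  add_mem' := by
    rintro _ _ ⟨x, hx, rfl⟩ ⟨y, hy, rfl⟩
    exact ⟨x + y, U.add_mem hx hy, auxPi_add ρ x y⟩
  smul_mem' := by
    rintro c _ ⟨x, hx, rfl⟩
    obtain ⟨r, rfl⟩ := hρ c
    exact ⟨r • x, U.smul_mem r hx, auxPi_smul ρ r x⟩

/-- socle part -/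
def auxW (hc : ∀ r, ∃ s, θ * r = s * θ) (U : Submodule R (Fin 4 → R)) : Submodule K (Fin 4 → K) where
  carrier := {v | ∃ x, θ • x ∈ U ∧ auxPi ρ x = v}
  zero_mem' := ⟨0, by simp, by ext; simp [auxPi]⟩
  add_mem' := by
    rintro _ _ ⟨x, hx, rfl⟩ ⟨y, hy, rfl⟩
    exact ⟨x + y, by rw [smul_add]; exact U.add_mem hx hy, auxPi_add ρ x y⟩
  smul_mem' := by
    rintro c _ ⟨x, hx, rfl⟩
    obtain ⟨r, rfl⟩ := hρ c
    obtain ⟨s, hs⟩ := hc r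
    exact ⟨r • x, by rw [smul_smul, hs, ← smul_smul]; exact U.smul_mem s hx, auxPi_smul ρ r x⟩

lemma aux_theta (hk : ∀ r, θ * r = 0 ↔ ρ r = 0) (x : Fin 4 → R) : θ • x = 0 ↔ auxPi ρ x = 0 := by
  simp [funext_iff, auxPi, hk]

lemma aux_theta2 (hr : ∀ r, ρ r = 0 → ∃ s, r = θ * s) (x : Fin 4 → R) (h : auxPi ρ x = 0) :
    ∃ y, x = θ • y := by
  have : ∀ i, ∃ s, x i = θ * s := fun i => hr _ (congrFun h i)
  choose y hy using this
  exact ⟨y, by ext i; simp [hy]⟩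

lemma auxW_mem (hk : ∀ r, θ * r = 0 ↔ ρ r = 0) (hc : ∀ r, ∃ s, θ * r = s * θ)
    (U : Submodule R (Fin 4 → R)) (x : Fin 4 → R) :
    auxPi ρ x ∈ auxW ρ hρ θ hc U ↔ θ • x ∈ U := by
  constructor
  · rintro ⟨y, hy, hxy⟩
    have : θ • (x - y) = 0 := by rw [aux_theta ρ θ hk, auxPi_sub, hxy, sub_self]
    rw [smul_sub, sub_eq_zero] at this
    rwa [this]
  · intro h; exact ⟨x, h, rfl⟩

lemma auxLW (hk : ∀ r, θ * r = 0 ↔ ρ r = 0) (hc : ∀ r, ∃ s, θ * r = s * θ)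
    (U : Submodule R (Fin 4 → R)) : auxL ρ hρ U ≤ auxW ρ hρ θ hc U := by
  rintro _ ⟨x, hx, rfl⟩
  exact (auxW_mem ρ hρ θ hk hc U x).2 (U.smul_mem θ hx)

/-- agreement -/
def auxAgr (p : Fin 4 → K) (U U' : Submodule R (Fin 4 → R)) : Prop :=
  ∃ x ∈ U, x ∈ U' ∧ auxPi ρ x = p

lemma aux_agr_iff (hk : ∀ r, θ * r = 0 ↔ ρ r = 0) (hc : ∀ r, ∃ s, θ * r = s * θ)
    (hr : ∀ r, ρ r = 0 → ∃ s, r = θ * s)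
    (U U' : Submodule R (Fin 4 → R)) (hW : auxW ρ hρ θ hc U = auxW ρ hρ θ hc U')
    (p : Fin 4 → K) (h : auxAgr ρ p U U') (x : Fin 4 → R) (hx : x ∈ U) (hxp : auxPi ρ x = p) : x ∈ U' := by
  obtain ⟨y, hy, hy', hyp⟩ := h
  obtain ⟨z, hz⟩ := aux_theta2 ρ θ hr (x - y) (by rw [auxPi_sub, hxp, hyp, sub_self])
  have h1 : θ • z ∈ U := hz ▸ U.sub_mem hx hy
  rw [← auxW_mem ρ hρ θ hk hc, hW, auxW_mem ρ hρ θ hk hc, ← hz] at h1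
  simpa using U'.add_mem h1 hy'

/-- value -/
lemma aux_val (hk : ∀ r, θ * r = 0 ↔ ρ r = 0) (hc : ∀ r, ∃ s, θ * r = s * θ)
    (hr : ∀ r, ρ r = 0 → ∃ s, r = θ * s) (w : Submodule K (Fin 4 → K)) (p : Fin 4 → K) :
    ∃ val : Submodule R (Fin 4 → R) → ((Fin 4 → K) ⧸ w),
      ∀ U U', auxW ρ hρ θ hc U = w → auxW ρ hρ θ hc U' = w → p ∈ auxL ρ hρ U → p ∈ auxL ρ hρ U' →
      val U = val U' → auxAgr ρ p U U' := by
  obtain ⟨s, hs⟩ := auxPi_surj ρ hρ p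
  have : ∀ U : Submodule R (Fin 4 → R), ∃ a : (Fin 4 → K) ⧸ w, p ∈ auxL ρ hρ U →
      ∃ x ∈ U, auxPi ρ x = p ∧ ∃ y, x - s = θ • y ∧ Submodule.Quotient.mk (auxPi ρ y) = a := by
    intro U
    by_cases h : p ∈ auxL ρ hρ U
    · obtain ⟨x, hx, hxp⟩ := h
      obtain ⟨y, hy⟩ := aux_theta2 ρ θ hr (x - s) (by rw [auxPi_sub, hxp, hs, sub_self])
      exact ⟨_, fun _ => ⟨x, hx, hxp, y, hy, rfl⟩⟩
    · exact ⟨0, fun h' => absurd h' h⟩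
  choose val hval using this
  refine ⟨val, fun U U' hU hU' hpU hpU' hv => ?_⟩
  obtain ⟨x, hx, hxp, y, hy, hya⟩ := hval U hpU
  obtain ⟨x', hx', hxp', y', hy', hya'⟩ := hval U' hpU'
  rw [← hya, ← hya', Submodule.Quotient.eq, ← auxPi_sub, ← hU', auxW_mem ρ hρ θ hk hc, smul_sub,
    ← hy, ← hy'] at hv
  refine ⟨x, hx, ?_, hxp⟩
  simpa using U'.add_mem hv hx'

lemma aux_eq (hk : ∀ r, θ * r = 0 ↔ ρ r = 0) (hc : ∀ r, ∃ s, θ * r = s * θ)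
    (hr : ∀ r, ρ r = 0 → ∃ s, r = θ * s) (U U' : Submodule R (Fin 4 → R))
    (hW : auxW ρ hρ θ hc U = auxW ρ hρ θ hc U') (p₁ p₂ : Fin 4 → K)
    (hsp : auxL ρ hρ U ≤ Submodule.span K {p₁, p₂})
    (h1 : auxAgr ρ p₁ U U') (h2 : auxAgr ρ p₂ U U') : U ≤ U' := by
  intro x hx
  obtain ⟨a, b, hab⟩ := Submodule.mem_span_pair.1 (hsp ⟨x, hx, rfl⟩)
  obtain ⟨a, rfl⟩ := hρ a
  obtain ⟨b, rfl⟩ := hρ b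
  refine aux_agr_iff ρ hρ θ hk hc hr U U' hW (auxPi ρ x) ?_ x hx rfl
  obtain ⟨y, hy, hy', hyp⟩ := h1
  obtain ⟨z, hz, hz', hzp⟩ := h2
  exact ⟨a • y + b • z, U.add_mem (U.smul_mem _ hy) (U.smul_mem _ hz),
    U'.add_mem (U'.smul_mem _ hy') (U'.smul_mem _ hz'), by
      rw [auxPi_add, auxPi_smul, auxPi_smul, hyp, hzp, hab]⟩

lemma aux_ranks [Finite R] [Finite K] (N : Ideal R) (hN : ∀ r, r ∈ N ↔ ρ r = 0) (hNK : Nat.card (R ⧸ N) = Nat.card K)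
    (hk : ∀ r, θ * r = 0 ↔ ρ r = 0) (hc : ∀ r, ∃ s, θ * r = s * θ)
    (hr : ∀ r, ρ r = 0 → ∃ s, r = θ * s) (hNc : Nat.card N = Nat.card K)
    (hθ : ρ θ = 0)
    (U : Submodule R (Fin 4 → R)) (e : U ≃ₗ[R] ((Fin 2 → R) × (R ⧸ N))) :
    Module.finrank K (auxL ρ hρ U) = 2 ∧ Module.finrank K (auxW ρ hρ θ hc U) = 3 := by
  have hq : 2 ≤ Nat.card K := aux_q
  have : Finite (R ⧸ N) := Quotient.finite _
  have hR : Nat.card R = Nat.card K ^ 2 := by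
    rw [Submodule.card_eq_card_quotient_mul_card N, hNc, hNK, sq]
  have hU : Nat.card U = Nat.card K ^ 5 := by
    rw [Nat.card_congr e.toEquiv, Nat.card_prod, Nat.card_fun, hR, hNK]; simp; ring
  -- kernel of theta
  let f : U →+ (Fin 4 → K) :=
    { toFun := fun u => auxPi ρ u
      map_zero' := by ext; simp [auxPi]
      map_add' := fun x y => auxPi_add ρ x y }
  have hker : Nat.card f.ker = Nat.card K ^ 3 := by
    let g : f.ker ≃ ((Fin 2 → N) × (R ⧸ N)) :=
      { toFun := fun u => (fun i => ⟨(e u.1).1 i, by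
          have hu : auxPi ρ (u.1 : Fin 4 → R) = 0 := u.2
          have h1 : θ • u.1 = 0 := Subtype.ext ((aux_theta ρ θ hk _).2 hu)
          have h2 : θ • e u.1 = 0 := by rw [← map_smul, h1, map_zero]
          rw [hN, ← hk]
          exact congrFun (congrArg Prod.fst h2) i⟩, (e u.1).2)
        invFun := fun z => ⟨e.symm (fun i => (z.1 i : R), z.2), by
          change auxPi ρ _ = 0
          rw [← aux_theta ρ θ hk]
          have : θ • ((fun i => (z.1 i : R), z.2) : (Fin 2 → R) × (R ⧸ N)) = 0 := by
            ext i
            · simp [hk, ← hN]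
            · obtain ⟨r, hr⟩ := Submodule.Quotient.mk_surjective N z.2
              simp only [Prod.smul_snd, Prod.snd_zero]
              rw [← hr, ← Submodule.Quotient.mk_smul, Submodule.Quotient.mk_eq_zero, hN]
              simp [hθ]
          have h2 : θ • e.symm ((fun i => (z.1 i : R), z.2) : (Fin 2 → R) × (R ⧸ N)) = 0 := by
            rw [← map_smul, this, map_zero]
          exact congrArg Subtype.val h2⟩
        left_inv := by intro u; simp
        right_inv := by intro z; simp }
    rw [Nat.card_congr g, Nat.card_prod, Nat.card_fun, hNc, hNK]; simp; ring
  have hrange : Nat.card f.range = Nat.card (auxL ρ hρ U) := by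
    apply Nat.card_congr
    apply Equiv.setCongr
    ext v
    constructor
    · rintro ⟨u, rfl⟩; exact ⟨u.1, u.2, rfl⟩
    · rintro ⟨x, hx, rfl⟩; exact ⟨⟨x, hx⟩, rfl⟩
  have hprod : Nat.card U = Nat.card f.range * Nat.card f.ker := by
    rw [AddSubgroup.card_eq_card_quotient_mul_card_addSubgroup f.ker,
      Nat.card_congr (QuotientAddGroup.quotientKerEquivRange f).toEquiv]
  have hWc : Nat.card (auxW ρ hρ θ hc U) = Nat.card f.ker := by
    symm
    choose t ht using aux_theta2 ρ θ hr
    have hπt : ∀ x : Fin 4 → R, auxPi ρ (θ • x) = 0 := by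
      intro x; rw [auxPi_smul, hθ, zero_smul]
    refine Nat.card_congr (Equiv.ofBijective
      (fun u : f.ker => (⟨auxPi ρ (t u.1 u.2), (auxW_mem ρ hρ θ hk hc U _).2 ((ht u.1 u.2) ▸ u.1.2)⟩ : auxW ρ hρ θ hc U)) ⟨?_, ?_⟩)
    · intro u u' h
      have h := congrArg Subtype.val h
      simp only at h
      rw [← sub_eq_zero, ← auxPi_sub, ← aux_theta ρ θ hk, smul_sub, sub_eq_zero] at h
      exact Subtype.ext (Subtype.ext ((ht u.1 u.2).trans (h.trans (ht u'.1 u'.2).symm)))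
    · rintro ⟨_, x, hx, rfl⟩
      refine ⟨⟨⟨θ • x, hx⟩, hπt x⟩, Subtype.ext ?_⟩
      change auxPi ρ (t (θ • x) _) = auxPi ρ x
      rw [← sub_eq_zero, ← auxPi_sub, ← aux_theta ρ θ hk, smul_sub, sub_eq_zero]
      exact (ht (θ • x) (hπt x)).symm
  have hLc : Nat.card (auxL ρ hρ U) = Nat.card K ^ 2 := by
    rw [hU, hker, hrange] at hprod
    have : Nat.card K ^ 5 = Nat.card K ^ 2 * Nat.card K ^ 3 := by ring
    rw [this] at hprod
    exact (Nat.eq_of_mul_eq_mul_right (by positivity) hprod).symm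
  rw [hker] at hWc
  rw [Module.natCard_eq_pow_finrank (K := K)] at hWc hLc
  exact ⟨Nat.pow_right_injective hq hLc, Nat.pow_right_injective hq hWc⟩

lemma aux_quot [Finite K] (w : Submodule K (Fin 4 → K)) (hw : Module.finrank K w = 3) :
    Nat.card ((Fin 4 → K) ⧸ w) = Nat.card K := by
  rw [Module.natCard_eq_pow_finrank (K := K)]
  have := Submodule.finrank_quotient_add_finrank w
  simp [hw] at this
  have h1 : Module.finrank K ((Fin 4 → K) ⧸ w) = 1 := by omega
  rw [h1, pow_one]

lemma aux_basis [Finite K] (l : Submodule K (Fin 4 → K)) (hl : Module.finrank K l = 2) (p : Fin 4 → K)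
    (hp : p ≠ 0) (hpl : p ∈ l) : ∃ p' ∈ l, l = Submodule.span K {p, p'} := by
  have : ∃ p' ∈ l, p' ∉ K ∙ p := by
    by_contra hcon
    push Not at hcon
    have := Submodule.finrank_mono (show l ≤ K ∙ p from hcon)
    rw [hl, finrank_span_singleton hp] at this
    omega
  obtain ⟨p', h1, h2⟩ := this
  refine ⟨p', h1, ?_⟩
  symm
  apply Submodule.eq_of_le_of_finrank_le
  · rw [Submodule.span_le]
    intro x hx
    rcases hx with rfl | rfl <;> assumption
  · have hlt : K ∙ p < Submodule.span K {p, p'} := by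
      refine lt_of_le_of_ne (Submodule.span_mono (by simp)) fun h => h2 ?_
      rw [h]; exact Submodule.subset_span (by simp)
    have := Submodule.finrank_lt_finrank_of_lt hlt
    rw [finrank_span_singleton hp] at this
    omega

include hρ in
lemma aux_main [Finite R] [Finite K] (N : Ideal R) (hN : ∀ r, r ∈ N ↔ ρ r = 0) (hNK : Nat.card (R ⧸ N) = Nat.card K)
    (hk : ∀ r, θ * r = 0 ↔ ρ r = 0) (hc : ∀ r, ∃ s, θ * r = s * θ)
    (hr : ∀ r, ρ r = 0 → ∃ s, r = θ * s) (hNc : Nat.card N = Nat.card K)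
    (hθ : ρ θ = 0)
    (𝓕 : Finset (Submodule R (Fin 4 → R)))
    (hshape : ∀ U ∈ 𝓕, Nonempty (U ≃ₗ[R] ((Fin 2 → R) × (R ⧸ N))))
    (hint : ∀ U ∈ 𝓕, ∀ U' ∈ 𝓕, ∃ P : Submodule R (Fin 4 → R),
      P ≤ U ⊓ U' ∧ Nonempty (P ≃ₗ[R] R)) :
    𝓕.card ≤ Nat.card K * (Nat.card K ^ 2 + 1) * (Nat.card K ^ 2 + Nat.card K + 1) := by
  have hrk : ∀ U ∈ 𝓕, Module.finrank K (auxL ρ hρ U) = 2 ∧ Module.finrank K (auxW ρ hρ θ hc U) = 3 := by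
    intro U hU
    obtain ⟨e⟩ := hshape U hU
    exact aux_ranks ρ hρ θ N hN hNK hk hc hr hNc hθ U e
  refine aux_core (K := K) (V := Fin 4 → K) (by simp) 𝓕 (auxL ρ hρ) (auxW ρ hρ θ hc) (auxAgr ρ)
    (fun U hU => (hrk U hU).1) (fun U hU => (hrk U hU).2) (fun U hU => auxLW ρ hρ θ hk hc U)
    ?_ ?_ ?_ ?_ ?_
  · intro U hU U' hU'
    obtain ⟨P, hP, ⟨e⟩⟩ := hint U hU U' hU'
    have hx := hP (e.symm 1).2
    refine ⟨auxPi ρ (e.symm 1 : P), ?_, ⟨_, hx.1, rfl⟩, ⟨_, hx.2, rfl⟩, ⟨_, hx.1, hx.2, rfl⟩⟩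
    rw [Ne, ← aux_theta ρ θ hk]
    intro h
    have h1 : θ • e.symm 1 = 0 := Subtype.ext h
    rw [← map_smul, smul_eq_mul] at h1
    have h2 : θ * 1 = 0 := by simpa using h1
    rw [hk] at h2
    simp at h2
  · rintro c p U U' ⟨x, h1, h2, rfl⟩
    obtain ⟨r, rfl⟩ := hρ c
    exact ⟨r • x, U.smul_mem r h1, U'.smul_mem r h2, auxPi_smul ρ r x⟩
  · rintro p U hU U' hU' U'' hU'' hW1 hW2 ⟨x, h1, h2, hxp⟩ ⟨y, h3, h4, hyp⟩
    exact ⟨x, h1, aux_agr_iff ρ hρ θ hk hc hr U'' U' hW2.symm p ⟨y, h4, h3, hyp⟩ x h2 hxp, hxp⟩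
  · intro w l G hG hGm
    rcases G.eq_empty_or_nonempty with rfl | ⟨U0, hU0⟩
    · simp
    have hl : Module.finrank K l = 2 := (hGm U0 hU0).2 ▸ (hrk U0 (hG hU0)).1
    have hw : Module.finrank K w = 3 := (hGm U0 hU0).1 ▸ (hrk U0 (hG hU0)).2
    obtain ⟨p, hpl, hp⟩ : ∃ p ∈ l, p ≠ 0 := by
      apply Submodule.exists_mem_ne_zero_of_ne_bot
      rintro rfl
      simp at hl
    obtain ⟨p', hpl', hspan⟩ := aux_basis l hl p hp hpl
    obtain ⟨v, hv⟩ := aux_val ρ hρ θ hk hc hr w p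
    obtain ⟨v', hv'⟩ := aux_val ρ hρ θ hk hc hr w p'
    have hinj : Function.Injective (fun U : G => (v U.1, v' U.1)) := by
      rintro ⟨U, hU⟩ ⟨U', hU'⟩ h
      obtain ⟨h1, h2⟩ := Prod.mk.inj h
      obtain ⟨a, b⟩ := hGm U hU
      obtain ⟨a', b'⟩ := hGm U' hU'
      apply Subtype.ext
      apply le_antisymm
      · exact aux_eq ρ hρ θ hk hc hr U U' (a.trans a'.symm) p p' (b.trans hspan).le
          (hv U U' a a' (b ▸ hpl) (b' ▸ hpl) h1) (hv' U U' a a' (b ▸ hpl') (b' ▸ hpl') h2)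
      · exact aux_eq ρ hρ θ hk hc hr U' U (a'.trans a.symm) p p' (b'.trans hspan).le
          (hv U' U a' a (b' ▸ hpl) (b ▸ hpl) h1.symm) (hv' U' U a' a (b' ▸ hpl') (b ▸ hpl') h2.symm)
    have : Finite ((Fin 4 → K) ⧸ w) := Quotient.finite _
    have := Nat.card_le_card_of_injective _ hinj
    rw [Nat.card_prod, aux_quot w hw] at this
    simpa [sq] using this
  · intro w l p hp hpl G hG hGm hagr
    rcases G.eq_empty_or_nonempty with rfl | ⟨U0, hU0⟩
    · simp
    have hl : Module.finrank K l = 2 := (hGm U0 hU0).2 ▸ (hrk U0 (hG hU0)).1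
    have hw : Module.finrank K w = 3 := (hGm U0 hU0).1 ▸ (hrk U0 (hG hU0)).2
    obtain ⟨p', hpl', hspan⟩ := aux_basis l hl p hp hpl
    obtain ⟨v', hv'⟩ := aux_val ρ hρ θ hk hc hr w p'
    have hinj : Function.Injective (fun U : G => v' U.1) := by
      rintro ⟨U, hU⟩ ⟨U', hU'⟩ h2
      obtain ⟨a, b⟩ := hGm U hU
      obtain ⟨a', b'⟩ := hGm U' hU'
      apply Subtype.ext
      apply le_antisymm
      · exact aux_eq ρ hρ θ hk hc hr U U' (a.trans a'.symm) p p' (b.trans hspan).le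
          (hagr U hU U' hU') (hv' U U' a a' (b ▸ hpl') (b' ▸ hpl') h2)
      · exact aux_eq ρ hρ θ hk hc hr U' U (a'.trans a.symm) p p' (b'.trans hspan).le
          (hagr U' hU' U hU) (hv' U' U a' a (b' ▸ hpl') (b ▸ hpl') h2.symm)
    have : Finite ((Fin 4 → K) ⧸ w) := Quotient.finite _
    have := Nat.card_le_card_of_injective _ hinj
    rw [aux_quot w hw] at this
    simpa using this
end Alg


/-- **Improved bound on intersecting families of line stripes in `PHG(3,R)`.** Let `R` be
a finite chain ring of length 2 (its left ideals form a chain, its maximal ideal `N`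
satisfies `N² = 0`, `N ≠ 0`, and `R/N ≅ F_q`). If `𝓕` is a family of submodules of `R⁴`,
each of shape `(2,2,1)` (isomorphic to `R ⊕ R ⊕ R/N`), such that any two members of `𝓕`
contain a common free rank-1 submodule, then `|𝓕| ≤ q(q²+1)(q²+q+1)`. -/
theorem line_stripes_improved_bound (q : ℕ) {R : Type*} [Ring R] [Fintype R]
    (hchain : ∀ I J : Ideal R, I ≤ J ∨ J ≤ I)
    (N : Ideal R) (hN : N.IsMaximal)
    (hN2 : ∀ a ∈ N, ∀ b ∈ N, a * b = 0) (hNne : N ≠ ⊥)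
    (hq : Nat.card (R ⧸ N) = q) (hq' : IsPrimePow q)
    (𝓕 : Finset (Submodule R (Fin 4 → R)))
    (hshape : ∀ U ∈ 𝓕, Nonempty (U ≃ₗ[R] ((Fin 2 → R) × (R ⧸ N))))
    (hint : ∀ U ∈ 𝓕, ∀ U' ∈ 𝓕, ∃ P : Submodule R (Fin 4 → R),
      P ≤ U ⊓ U' ∧ Nonempty (P ≃ₗ[R] R)) :
    𝓕.card ≤ q * (q ^ 2 + 1) * (q ^ 2 + q + 1) := by
  classical
  have hprop : ∀ r, r ∉ N → ∃ s, s * r = 1 ∧ r * s = 1 := by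
    intro r hr
    have h1 : N ≤ Ideal.span {r} := by
      rcases hchain N (Ideal.span {r}) with h | h
      · exact h
      · exact absurd (h (Ideal.mem_span_singleton_self r)) hr
    have h2 : Ideal.span {r} = ⊤ := by
      by_contra hne
      exact hr ((hN.eq_of_le hne h1) ▸ Ideal.mem_span_singleton_self r)
    have h3 : (1 : R) ∈ Ideal.span {r} := h2 ▸ Submodule.mem_top
    obtain ⟨s, hs⟩ := Ideal.mem_span_singleton'.1 h3
    exact ⟨s, hs, mul_eq_one_comm.1 hs⟩
  have h1N : (1 : R) ∉ N := fun h => hN.ne_top ((Ideal.eq_top_iff_one N).2 h)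
  have htwo : ∀ a ∈ N, ∀ r, a * r ∈ N := by
    intro a ha r
    by_contra h
    obtain ⟨s, hs, -⟩ := hprop _ h
    have h2 : (s * a) * r = 1 := by rw [mul_assoc]; exact hs
    have h3 : r * (s * a) = 1 := mul_eq_one_comm.1 h2
    exact h1N (h3 ▸ N.mul_mem_left r (N.mul_mem_left s ha))
  have inst : N.IsTwoSided := ⟨fun {a} r ha => htwo a ha r⟩
  have hnt : Nontrivial (R ⧸ N) := Submodule.Quotient.nontrivial_iff.2 hN.ne_top
  let _ : DivisionRing (R ⧸ N) := DivisionRing.ofIsUnitOrEqZero (by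
    intro a
    obtain ⟨r, rfl⟩ := Ideal.Quotient.mk_surjective a
    by_cases h : r ∈ N
    · right; exact Ideal.Quotient.eq_zero_iff_mem.2 h
    · left
      obtain ⟨s, h1, h2⟩ := hprop r h
      exact IsUnit.map (Ideal.Quotient.mk N) ⟨⟨r, s, h2, h1⟩, rfl⟩)
  have hfin : Finite (R ⧸ N) := Quotient.finite _
  let ρ : R →+* R ⧸ N := Ideal.Quotient.mk N
  have hNρ : ∀ r, r ∈ N ↔ ρ r = 0 := fun r => Ideal.Quotient.eq_zero_iff_mem.symm
  obtain ⟨θ, hθN, hθ0⟩ := Submodule.exists_mem_ne_zero_of_ne_bot hNne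
  have hgen : ∀ y ∈ N, ∃ s, y = s * θ := by
    intro y hy
    rcases hchain (Ideal.span {y}) (Ideal.span {θ}) with h | h
    · obtain ⟨s, hs⟩ := Ideal.mem_span_singleton'.1 (h (Ideal.mem_span_singleton_self y))
      exact ⟨s, hs.symm⟩
    · obtain ⟨r, hr⟩ := Ideal.mem_span_singleton'.1 (h (Ideal.mem_span_singleton_self θ))
      have hrN : r ∉ N := fun hrN => hθ0 (hr ▸ hN2 r hrN y hy)
      obtain ⟨s, hs, -⟩ := hprop r hrN
      exact ⟨s, by rw [← hr, ← mul_assoc, hs, one_mul]⟩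
  have hk' : ∀ r, θ * r = 0 ↔ r ∈ N := by
    intro r
    refine ⟨fun h => ?_, fun h => hN2 θ hθN r h⟩
    by_contra hr
    obtain ⟨s, -, hs⟩ := hprop r hr
    apply hθ0
    rw [← mul_one θ, ← hs, ← mul_assoc, h, zero_mul]
  have hkl : ∀ r, r * θ = 0 ↔ r ∈ N := by
    intro r
    refine ⟨fun h => ?_, fun h => hN2 r h θ hθN⟩
    by_contra hr
    obtain ⟨s, hs, -⟩ := hprop r hr
    apply hθ0
    rw [← one_mul θ, ← hs, mul_assoc, h, mul_zero]
  -- left and right multiplication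
  let fl : R →+ R := AddMonoidHom.mulRight θ
  let fr : R →+ R := AddMonoidHom.mulLeft θ
  have hcl : Nat.card R = Nat.card fl.range * Nat.card fl.ker := by
    rw [AddSubgroup.card_eq_card_quotient_mul_card_addSubgroup fl.ker,
      Nat.card_congr (QuotientAddGroup.quotientKerEquivRange fl).toEquiv]
  have hcr : Nat.card R = Nat.card fr.range * Nat.card fr.ker := by
    rw [AddSubgroup.card_eq_card_quotient_mul_card_addSubgroup fr.ker,
      Nat.card_congr (QuotientAddGroup.quotientKerEquivRange fr).toEquiv]
  have hkerl : fl.ker = N.toAddSubgroup := by ext r; exact hkl r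
  have hkerr : fr.ker = N.toAddSubgroup := by ext r; exact hk' r
  have hrangel : fl.range = N.toAddSubgroup := by
    ext r
    constructor
    · rintro ⟨s, rfl⟩; exact N.mul_mem_left s hθN
    · intro h
      obtain ⟨s, hs⟩ := hgen r h
      exact ⟨s, hs.symm⟩
  have hNcard : Nat.card N.toAddSubgroup = Nat.card N := rfl
  have hNpos : 0 < Nat.card N := Nat.card_pos
  have hRN : Nat.card R = Nat.card (R ⧸ N) * Nat.card N := by
    first
      | exact Submodule.card_eq_card_quotient_mul_card N
      | exact (Submodule.card_eq_card_quotient_mul_card N).trans (mul_comm _ _)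
  have hNc : Nat.card N = Nat.card (R ⧸ N) := by
    rw [hkerl, hrangel, hNcard, hRN] at hcl
    exact (Nat.eq_of_mul_eq_mul_right hNpos hcl).symm
  have hrangec : Nat.card fr.range = Nat.card N := by
    rw [hkerr, hNcard, hRN] at hcr
    rw [hNc]
    exact (Nat.eq_of_mul_eq_mul_right hNpos hcr).symm
  have hrle : fr.range ≤ N.toAddSubgroup := by
    rintro _ ⟨s, rfl⟩; exact htwo θ hθN s
  have hreq : fr.range = N.toAddSubgroup :=
    AddSubgroup.eq_of_le_of_card_ge hrle (by rw [hrangec, hNcard])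
  have hr : ∀ r, ρ r = 0 → ∃ s, r = θ * s := by
    intro r h
    have : r ∈ fr.range := by rw [hreq]; exact (hNρ r).2 h
    obtain ⟨s, hs⟩ := this
    exact ⟨s, hs.symm⟩
  have := aux_main ρ Ideal.Quotient.mk_surjective θ N hNρ rfl
    (fun r => (hk' r).trans (hNρ r)) (fun r => hgen _ (htwo θ hθN r)) hr hNc ((hNρ θ).1 hθN) 𝓕 hshape hint
  rwa [hq] at this
end
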